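/- (Dimensional reduction at the boundary) Let 1 ≤ p ≤ n, let G_p be a symmetric positive definite p×p matrix, and let G be the n×n block-diagonal matrix with upper-left block G_p and all other entries zero. Let U : ℝⁿ → ℝ have superquadratic growth and define U_p : ℝᵖ → ℝ by U_p(y) = U(y, 0). Then the continuous extension of the n-dimensional Luttinger-Ward functional satisfies Φ_n[G; U] = Φ_p[G_p; U_p]. -/

import Mathlib

open MeasureTheory Matrix Filter Topology Real Asymptotics

attribute [local instance] Matrix.normedAddCommGroup Matrix.normedSpace

noncomputable section

/-- The partition function `Z[A] = ∫ exp(-½ xᵀAx - U(x)) dx`. -/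
def Zfun (n : ℕ) (U : (Fin n → ℝ) → ℝ) (A : Matrix (Fin n) (Fin n) ℝ) : ℝ :=
  ∫ x : Fin n → ℝ, Real.exp (-(1 / 2) * (x ⬝ᵥ A.mulVec x) - U x)

/-- The free energy `Ω[A] = -log Z[A]`. -/
def Omega (n : ℕ) (U : (Fin n → ℝ) → ℝ) (A : Matrix (Fin n) (Fin n) ℝ) : ℝ :=
  - Real.log (Zfun n U A)

/-- `U` is continuous with superquadratic growth: for every `c > 0`,
`U x - c * |x|² → +∞` as `|x| → ∞`. -/
def SuperQuadratic {n : ℕ} (U : (Fin n → ℝ) → ℝ) : Prop :=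
  Continuous U ∧ ∀ c : ℝ, 0 < c →
    Tendsto (fun x : Fin n → ℝ => U x - c * ‖x‖ ^ 2) (cocompact _) atTop

/-- A probability density on `ℝⁿ` with finite second moments and finite
differential entropy. -/
def IsGoodDensity {n : ℕ} (ρ : (Fin n → ℝ) → ℝ) : Prop :=
  Measurable ρ ∧ (∀ x, 0 ≤ ρ x) ∧ (∫ x, ρ x) = 1 ∧
  (∀ i j : Fin n, Integrable fun x => x i * x j * ρ x) ∧
  Integrable fun x => ρ x * Real.log (ρ x)

/-- Differential entropy `S(ρ) = -∫ ρ log ρ`. -/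
def entropy {n : ℕ} (ρ : (Fin n → ℝ) → ℝ) : ℝ := - ∫ x, ρ x * Real.log (ρ x)

/-- Second-moment matrix `𝒢(ρ) = ∫ x xᵀ ρ(x) dx`. -/
def momMatrix {n : ℕ} (ρ : (Fin n → ℝ) → ℝ) : Matrix (Fin n) (Fin n) ℝ :=
  Matrix.of fun i j => ∫ x, x i * x j * ρ x

/-- `𝓕[G;U] = sup { S(ρ) - ∫ U ρ : ρ ∈ 𝓜, 𝒢(ρ) = G }`. -/
def Ffun (n : ℕ) (U : (Fin n → ℝ) → ℝ) (G : Matrix (Fin n) (Fin n) ℝ) : ℝ :=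
  sSup { r : ℝ | ∃ ρ : (Fin n → ℝ) → ℝ, IsGoodDensity ρ ∧
    (Integrable fun x => U x * ρ x) ∧ momMatrix ρ = G ∧
    r = entropy ρ - ∫ x, U x * ρ x }

/-- The Luttinger-Ward functional `Φ[G;U] = 2𝓕[G;U] - Tr[log G] - n log(2πe)`.
(For positive definite `G`, `Tr[log G] = log det G`.) -/
def Phi (n : ℕ) (U : (Fin n → ℝ) → ℝ) (G : Matrix (Fin n) (Fin n) ℝ) : ℝ :=
  2 * Ffun n U G - Real.log G.det - (n : ℝ) * Real.log (2 * π * Real.exp 1)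

/-- The continuous linear functional `H ↦ Tr[S * H]` on matrices. -/
def tracePairing {n : ℕ} (S : Matrix (Fin n) (Fin n) ℝ) :
    Matrix (Fin n) (Fin n) ℝ →L[ℝ] ℝ :=
  LinearMap.toContinuousLinearMap
    { toFun := fun H => (S * H).trace
      map_add' := fun H K => by simp [Matrix.mul_add]
      map_smul' := fun c H => by simp [Matrix.mul_smul] }

/-- bounded compactly supported densities -/
def IsB {m : ℕ} (ρ : (Fin m → ℝ) → ℝ) (C R : ℝ) : Prop :=
  Measurable ρ ∧ (∀ x, 0 ≤ ρ x) ∧ (∀ x, ρ x ≤ C) ∧ (∀ x, R < ‖x‖ → ρ x = 0) ∧ (∫ x, ρ x) = 1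

/-- entrywise pairing -/
def pairM {m : ℕ} (A M : Matrix (Fin m) (Fin m) ℝ) : ℝ := ∑ i, ∑ j, A i j * M i j

/-- Gibbs weight -/
def gibbsW {m : ℕ} (U : (Fin m → ℝ) → ℝ) (A : Matrix (Fin m) (Fin m) ℝ) (x : Fin m → ℝ) : ℝ :=
  Real.exp (-(1 / 2) * (x ⬝ᵥ A.mulVec x) - U x)

lemma quad_eq {m : ℕ} (A : Matrix (Fin m) (Fin m) ℝ) (x : Fin m → ℝ) :
    x ⬝ᵥ A.mulVec x = ∑ i, ∑ j, A i j * (x i * x j) := by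
  simp only [dotProduct, mulVec, Finset.mul_sum]
  refine Finset.sum_congr rfl fun i _ => Finset.sum_congr rfl fun j _ => by ring

lemma integrable_of_bdd_supp {E : Type*} [NormedAddCommGroup E] [MeasureSpace E] [ProperSpace E]
    [OpensMeasurableSpace E] [IsFiniteMeasureOnCompacts (volume : Measure E)]
    {h : E → ℝ} (hm : Measurable h) {K R : ℝ} (hb : ∀ x, ‖x‖ ≤ R → |h x| ≤ K)
    (hs : ∀ x, R < ‖x‖ → h x = 0) : Integrable h := by
  have h1 : IntegrableOn h (Metric.closedBall 0 R) := by
    refine Measure.integrableOn_of_bounded (M := K) ?_ hm.aestronglyMeasurable ?_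
    · exact (isCompact_closedBall (0 : E) R).measure_lt_top.ne
    · refine (ae_restrict_iff' Metric.isClosed_closedBall.measurableSet).2 (Eventually.of_forall ?_)
      intro x hx
      exact hb x (by simpa using hx)
  refine (integrableOn_iff_integrable_of_support_subset ?_).1 h1
  intro x hx
  by_contra hc
  exact hx (hs x (by simpa using hc))

lemma IsB.integrable_mul {m : ℕ} {ρ : (Fin m → ℝ) → ℝ} {C R : ℝ} (h : IsB ρ C R)
    {f : (Fin m → ℝ) → ℝ} (hf : Continuous f) : Integrable fun x => f x * ρ x := by
  obtain ⟨K, hK⟩ := (isCompact_closedBall (0 : Fin m → ℝ) R).exists_bound_of_continuousOn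
    hf.continuousOn
  refine integrable_of_bdd_supp (K := K * C) (R := R) (hf.measurable.mul h.1) ?_ ?_
  · intro x hx
    rw [abs_mul]
    have := hK x (by simpa using hx)
    rw [abs_of_nonneg (h.2.1 x)]
    exact mul_le_mul this (h.2.2.1 x) (h.2.1 x) ((norm_nonneg _).trans this)
  · intro x hx
    rw [h.2.2.2.1 x hx, mul_zero]

lemma IsB.integrable {m : ℕ} {ρ : (Fin m → ℝ) → ℝ} {C R : ℝ} (h : IsB ρ C R) : Integrable ρ := by
  simpa using h.integrable_mul (f := fun _ => 1) continuous_const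

lemma IsB.integrable_log {m : ℕ} {ρ : (Fin m → ℝ) → ℝ} {C R : ℝ} (h : IsB ρ C R) :
    Integrable fun x => ρ x * Real.log (ρ x) := by
  obtain ⟨K, hK⟩ := (isCompact_Icc (a := (0:ℝ)) (b := C)).exists_bound_of_continuousOn
    Real.continuous_mul_log.continuousOn
  refine integrable_of_bdd_supp (K := K) (R := R) (Real.continuous_mul_log.measurable.comp h.1) ?_ ?_
  · intro x hx
    exact hK _ ⟨h.2.1 x, h.2.2.1 x⟩
  · intro x hx
    rw [h.2.2.2.1 x hx, zero_mul]

lemma IsB.good {m : ℕ} {ρ : (Fin m → ℝ) → ℝ} {C R : ℝ} (h : IsB ρ C R) : IsGoodDensity ρ :=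
  ⟨h.1, h.2.1, h.2.2.2.2, fun i j => h.integrable_mul (f := fun x => x i * x j) (by fun_prop),
    h.integrable_log⟩

lemma klpt {a b : ℝ} (ha : 0 ≤ a) (hb : 0 < b) : a - b ≤ a * Real.log a - a * Real.log b := by
  rcases ha.eq_or_lt with rfl | ha
  · simpa using hb.le
  · have h := Real.log_le_sub_one_of_pos (div_pos hb ha)
    rw [Real.log_div hb.ne' ha.ne'] at h
    have h2 := mul_le_mul_of_nonneg_left h ha.le
    have : a * (b / a - 1) = b - a := by field_simp
    nlinarith

lemma good_integrable {m : ℕ} {ρ : (Fin m → ℝ) → ℝ} (h : IsGoodDensity ρ) : Integrable ρ := by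
  by_contra hc
  have := h.2.2.1
  rw [integral_undef hc] at this
  exact zero_ne_one this

lemma integral_quad {m : ℕ} {ρ : (Fin m → ℝ) → ℝ}
    (h : ∀ i j : Fin m, Integrable fun x => x i * x j * ρ x) (A : Matrix (Fin m) (Fin m) ℝ) :
    (Integrable fun x => (x ⬝ᵥ A.mulVec x) * ρ x) ∧
    ∫ x, (x ⬝ᵥ A.mulVec x) * ρ x = pairM A (momMatrix ρ) := by
  have e : (fun x => (x ⬝ᵥ A.mulVec x) * ρ x) =
      fun x => ∑ i, ∑ j, A i j * (x i * x j * ρ x) := by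
    funext x
    rw [quad_eq, Finset.sum_mul]
    refine Finset.sum_congr rfl fun i _ => ?_
    rw [Finset.sum_mul]
    refine Finset.sum_congr rfl fun j _ => by ring
  have hi : ∀ i j : Fin m, Integrable fun x => A i j * (x i * x j * ρ x) :=
    fun i j => (h i j).const_mul _
  rw [e]
  refine ⟨integrable_finsetSum _ fun i _ => integrable_finsetSum _ fun j _ => hi i j, ?_⟩
  rw [integral_finsetSum _ fun i _ => integrable_finsetSum _ fun j _ => hi i j]
  refine Finset.sum_congr rfl fun i _ => ?_
  rw [integral_finsetSum _ fun j _ => hi i j]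
  refine Finset.sum_congr rfl fun j _ => ?_
  rw [integral_const_mul]
  rfl

lemma Z_pos {m : ℕ} {U : (Fin m → ℝ) → ℝ} {A : Matrix (Fin m) (Fin m) ℝ}
    (hZ : Integrable (gibbsW U A)) : 0 < Zfun m U A := by
  exact integral_exp_pos hZ

lemma gibbs {m : ℕ} {U : (Fin m → ℝ) → ℝ} {A : Matrix (Fin m) (Fin m) ℝ}
    (hZ : Integrable (gibbsW U A)) {ρ : (Fin m → ℝ) → ℝ} (h : IsGoodDensity ρ)
    (hU : Integrable fun x => U x * ρ x) :
    entropy ρ - ∫ x, U x * ρ x ≤ 1 / 2 * pairM A (momMatrix ρ) + Real.log (Zfun m U A) := by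
  have hZ0 := Z_pos hZ
  set Z := Zfun m U A with hZdef
  have hρ := good_integrable h
  obtain ⟨hq, hq2⟩ := integral_quad h.2.2.2.1 A
  have hpt : ∀ x, 0 ≤ ρ x * Real.log (ρ x) + 1 / 2 * ((x ⬝ᵥ A.mulVec x) * ρ x) + U x * ρ x
      + (Real.log Z - 1) * ρ x + gibbsW U A x / Z := by
    intro x
    have := klpt (h.2.1 x) (div_pos (Real.exp_pos (-(1 / 2) * (x ⬝ᵥ A.mulVec x) - U x)) hZ0)
    rw [Real.log_div (Real.exp_ne_zero _) hZ0.ne', Real.log_exp] at this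
    unfold gibbsW
    linarith
  have i1 := h.2.2.2.2
  have i2 := hq.const_mul (1 / 2)
  have i4 := hρ.const_mul (Real.log Z - 1)
  have i5 := hZ.div_const Z
  have hint' : 0 ≤ ∫ x, (ρ x * Real.log (ρ x) + 1 / 2 * ((x ⬝ᵥ A.mulVec x) * ρ x) + U x * ρ x
      + (Real.log Z - 1) * ρ x + gibbsW U A x / Z) := integral_nonneg (fun x => hpt x)
  have j1 : Integrable fun x => ρ x * Real.log (ρ x) + 1 / 2 * ((x ⬝ᵥ A.mulVec x) * ρ x) := i1.add i2
  have j2 : Integrable fun x => ρ x * Real.log (ρ x) + 1 / 2 * ((x ⬝ᵥ A.mulVec x) * ρ x)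
      + U x * ρ x := j1.add hU
  have j3 : Integrable fun x => ρ x * Real.log (ρ x) + 1 / 2 * ((x ⬝ᵥ A.mulVec x) * ρ x)
      + U x * ρ x + (Real.log Z - 1) * ρ x := j2.add i4
  rw [integral_add j3 i5, integral_add j2 i4,
    integral_add j1 hU, integral_add i1 i2, integral_const_mul, integral_const_mul,
    integral_div, hq2, h.2.2.1] at hint'
  have : (∫ x, gibbsW U A x) = Z := rfl
  rw [this, div_self hZ0.ne'] at hint'
  unfold entropy
  linarith

lemma sq_le_sum {m : ℕ} (x : Fin m → ℝ) (i : Fin m) : x i ^ 2 ≤ ∑ k, x k ^ 2 :=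
  Finset.single_le_sum (f := fun k => x k ^ 2) (fun k _ => sq_nonneg _) (Finset.mem_univ i)

lemma quad_bound {m : ℕ} (A : Matrix (Fin m) (Fin m) ℝ) :
    ∃ a : ℝ, 0 < a ∧ ∀ x : Fin m → ℝ, |x ⬝ᵥ A.mulVec x| ≤ a * ∑ i, x i ^ 2 := by
  refine ⟨∑ i, ∑ j, |A i j| + 1, by positivity, fun x => ?_⟩
  rw [quad_eq]
  have hs : 0 ≤ ∑ i, x i ^ 2 := Finset.sum_nonneg fun i _ => sq_nonneg _
  calc |∑ i, ∑ j, A i j * (x i * x j)| ≤ ∑ i, ∑ j, |A i j| * ∑ k, x k ^ 2 := by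
        refine (Finset.abs_sum_le_sum_abs _ _).trans (Finset.sum_le_sum fun i _ => ?_)
        refine (Finset.abs_sum_le_sum_abs _ _).trans (Finset.sum_le_sum fun j _ => ?_)
        rw [abs_mul]
        refine mul_le_mul_of_nonneg_left ?_ (abs_nonneg _)
        have h1 := sq_le_sum x i
        have h2 := sq_le_sum x j
        rw [abs_le]
        constructor <;> nlinarith [sq_nonneg (x i + x j), sq_nonneg (x i - x j)]
    _ = (∑ i, ∑ j, |A i j|) * ∑ k, x k ^ 2 := by simp_rw [Finset.sum_mul]
    _ ≤ _ := by nlinarith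

lemma SuperQuadratic.lower {m : ℕ} {U : (Fin m → ℝ) → ℝ} (hU : SuperQuadratic U) {c : ℝ}
    (hc : 0 < c) : ∃ C : ℝ, ∀ x, c * ∑ i, x i ^ 2 - C ≤ U x := by
  have hcont : Continuous (fun x : Fin m → ℝ => U x - (c * (m + 1)) * ‖x‖ ^ 2) := by
    have := hU.1
    fun_prop
  obtain ⟨x0, hx0⟩ := hcont.exists_forall_le (hU.2 (c * (m + 1)) (by positivity))
  refine ⟨-(U x0 - (c * (m + 1)) * ‖x0‖ ^ 2), fun x => ?_⟩
  have h1 : ∑ i, x i ^ 2 ≤ (m + 1) * ‖x‖ ^ 2 := by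
    calc ∑ i, x i ^ 2 ≤ ∑ i : Fin m, ‖x‖ ^ 2 := by
          refine Finset.sum_le_sum fun i _ => ?_
          rw [← sq_abs]
          exact pow_le_pow_left₀ (abs_nonneg _) (norm_le_pi_norm x i) 2
      _ = m * ‖x‖ ^ 2 := by simp
      _ ≤ _ := by nlinarith [sq_nonneg ‖x‖]
  have h2 := hx0 x
  have h3 := mul_le_mul_of_nonneg_left h1 hc.le
  nlinarith

lemma integrable_exp_sum {m : ℕ} {b : ℝ} (hb : 0 < b) :
    Integrable fun x : Fin m → ℝ => Real.exp (-b * ∑ i, x i ^ 2) := by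
  have := Integrable.fintype_prod (ι := Fin m) (f := fun _ (t : ℝ) => Real.exp (-b * t ^ 2))
    (μ := fun _ => volume) (fun _ => integrable_exp_neg_mul_sq hb)
  refine this.congr (Eventually.of_forall fun x => ?_)
  simp only [Finset.mul_sum, Real.exp_sum]

lemma SuperQuadratic.quad_lower {m : ℕ} {U : (Fin m → ℝ) → ℝ} (hU : SuperQuadratic U)
    (A : Matrix (Fin m) (Fin m) ℝ) : ∃ C : ℝ, ∀ x, gibbsW U A x ≤ Real.exp (C + -1 * ∑ i, x i ^ 2) := by
  obtain ⟨a, ha, hA⟩ := quad_bound A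
  obtain ⟨C, hC⟩ := hU.lower (c := a + 1) (by linarith)
  refine ⟨C, fun x => Real.exp_le_exp.2 ?_⟩
  have h1 := abs_le.1 (hA x)
  have h2 := hC x
  have hs : 0 ≤ ∑ i, x i ^ 2 := Finset.sum_nonneg fun i _ => sq_nonneg _
  nlinarith

lemma continuous_gibbsW {m : ℕ} {U : (Fin m → ℝ) → ℝ} (hU : Continuous U)
    (A : Matrix (Fin m) (Fin m) ℝ) : Continuous (gibbsW U A) := by
  unfold gibbsW
  simp_rw [quad_eq]
  fun_prop

lemma SuperQuadratic.integrable {m : ℕ} {U : (Fin m → ℝ) → ℝ} (hU : SuperQuadratic U)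
    (A : Matrix (Fin m) (Fin m) ℝ) : Integrable (gibbsW U A) := by
  obtain ⟨C, hC⟩ := hU.quad_lower A
  refine ((integrable_exp_sum (m := m) one_pos).const_mul (Real.exp C)).mono'
    (continuous_gibbsW hU.1 A).aestronglyMeasurable (Eventually.of_forall fun x => ?_)
  rw [← Real.exp_add, Real.norm_of_nonneg (show 0 ≤ gibbsW U A x from (Real.exp_pos _).le)]
  exact hC x


/-- one-dimensional even densities with compact support -/
structure Is1 (g : ℝ → ℝ) (C r ε : ℝ) : Prop where
  meas : Measurable g
  nonneg : ∀ t, 0 ≤ g t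
  bdd : ∀ t, g t ≤ C
  supp : ∀ t, r < |t| → g t = 0
  even : ∀ t, g (-t) = g t
  r0 : 0 ≤ r
  int1 : ∫ t, g t = 1
  int2 : ∫ t, t ^ 2 * g t = ε

lemma Is1.odd {g : ℝ → ℝ} {C r ε : ℝ} (h : Is1 g C r ε) : ∫ t, t * g t = 0 := by
  have h1 := integral_neg_eq_self (fun t => t * g t) volume
  have h2 : ∫ t, (-t) * g (-t) = - ∫ t, t * g t := by
    rw [← integral_neg]
    congr 1
    funext t
    rw [h.even]; ring
  rw [h2] at h1
  linarith

lemma prod_isB {g : ℝ → ℝ} {C r ε : ℝ} (h : Is1 g C r ε) (q : ℕ) :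
    IsB (fun w : Fin q → ℝ => ∏ i, g (w i)) (C ^ q) r := by
  refine ⟨?_, ?_, ?_, ?_, ?_⟩
  · have := h.meas
    fun_prop
  · exact fun w => Finset.prod_nonneg fun i _ => h.nonneg _
  · intro w
    calc ∏ i, g (w i) ≤ ∏ i : Fin q, C := Finset.prod_le_prod (fun i _ => h.nonneg _) fun i _ => h.bdd _
      _ = C ^ q := by simp
  · intro w hw
    by_contra hc
    have : ‖w‖ ≤ r := (pi_norm_le_iff_of_nonneg h.r0).2 fun i => by
      by_contra hi
      push Not at hi
      exact hc (Finset.prod_eq_zero (Finset.mem_univ i) (h.supp _ hi))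
    linarith
  · rw [integral_fintype_prod_volume_eq_prod (f := fun (_ : Fin q) t => g t)]
    simp [h.int1]

lemma prod_mom {g : ℝ → ℝ} {C r ε : ℝ} (h : Is1 g C r ε) (q : ℕ) :
    momMatrix (fun w : Fin q → ℝ => ∏ i, g (w i)) = ε • (1 : Matrix (Fin q) (Fin q) ℝ) := by
  ext i j
  simp only [momMatrix, Matrix.of_apply]
  have e : ∀ w : Fin q → ℝ, w i * w j * ∏ k, g (w k) =
      ∏ k, ((if k = i then w k else 1) * (if k = j then w k else 1) * g (w k)) := by
    intro w
    rw [Finset.prod_mul_distrib, Finset.prod_mul_distrib]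
    simp [Finset.prod_ite_eq']
  simp_rw [e]
  rw [integral_fintype_prod_volume_eq_prod
    (f := fun (k : Fin q) t => (if k = i then t else 1) * (if k = j then t else 1) * g t)]
  by_cases hij : i = j
  · subst hij
    have : ∀ k, ∫ t, ((if k = i then t else 1) * (if k = i then t else 1) * g t) =
        if k = i then ε else 1 := by
      intro k
      by_cases hk : k = i
      · simp only [hk, if_true]
        rw [← h.int2]
        congr 1; funext t; ring
      · simp [hk, h.int1]
    simp_rw [this]
    simp [Finset.prod_ite_eq']
  · rw [Finset.prod_eq_zero (Finset.mem_univ i)]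
    · simp [hij]
    · simp [hij, h.odd]

lemma prod_entropy {g : ℝ → ℝ} {C r ε : ℝ} (h : Is1 g C r ε) (q : ℕ) :
    entropy (fun w : Fin q → ℝ => ∏ i, g (w i)) = q * (- ∫ t, g t * Real.log (g t)) := by
  have e : ∀ w : Fin q → ℝ, (∏ k, g (w k)) * Real.log (∏ k, g (w k)) =
      ∑ i, ∏ k, ((if k = i then Real.log (g (w k)) else 1) * g (w k)) := by
    intro w
    have : ∀ i, ∏ k, ((if k = i then Real.log (g (w k)) else 1) * g (w k)) =
        Real.log (g (w i)) * ∏ k, g (w k) := by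
      intro i
      rw [Finset.prod_mul_distrib]
      simp [Finset.prod_ite_eq']
    simp_rw [this]
    rw [← Finset.sum_mul, mul_comm]
    by_cases h0 : ∏ k, g (w k) = 0
    · rw [h0]; simp
    · rw [Real.log_prod]
      intro k _ hk
      exact h0 (Finset.prod_eq_zero (Finset.mem_univ k) hk)
  have hgint : Integrable g := by
    refine integrable_of_bdd_supp (K := C) (R := r) h.meas (fun x _ => ?_) h.supp
    rw [abs_of_nonneg (h.nonneg x)]; exact h.bdd x
  have hglog : Integrable fun t => Real.log (g t) * g t := by
    obtain ⟨K, hK⟩ := (isCompact_Icc (a := (0:ℝ)) (b := C)).exists_bound_of_continuousOn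
      Real.continuous_mul_log.continuousOn
    refine integrable_of_bdd_supp (K := K) (R := r) ?_ ?_ ?_
    · have := h.meas
      fun_prop
    · intro x hx
      rw [mul_comm]
      exact hK _ ⟨h.nonneg x, h.bdd x⟩
    · intro x hx
      rw [h.supp x hx, mul_zero]
  unfold entropy
  simp_rw [e]
  rw [integral_finsetSum]
  · have : ∀ i : Fin q, ∫ w : Fin q → ℝ, ∏ k, ((if k = i then Real.log (g (w k)) else 1) * g (w k)) =
        ∫ t, g t * Real.log (g t) := by
      intro i
      rw [integral_fintype_prod_volume_eq_prod
        (f := fun (k : Fin q) t => (if k = i then Real.log (g t) else 1) * g t)]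
      rw [Finset.prod_eq_single i]
      · simp [mul_comm]
      · intro k _ hk
        simp [hk, h.int1]
      · simp
    simp_rw [this]
    simp
  · intro i _
    refine Integrable.fintype_prod (f := fun (k : Fin q) t => (if k = i then Real.log (g t) else 1) * g t)
      (μ := fun _ => volume) ?_
    intro k
    by_cases hk : k = i
    · simpa [hk] using hglog
    · simpa [hk] using hgint

lemma gauss0 : Integrable (fun t : ℝ => Real.exp (-(1/2) * t ^ 2)) ∧
    ∫ t : ℝ, Real.exp (-(1/2) * t ^ 2) = √(2 * π) := by
  refine ⟨integrable_exp_neg_mul_sq (by norm_num), ?_⟩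
  rw [integral_gaussian]
  congr 1
  ring

lemma gauss2 : Integrable (fun t : ℝ => t ^ 2 * Real.exp (-(1/2) * t ^ 2)) ∧
    ∫ t : ℝ, t ^ 2 * Real.exp (-(1/2) * t ^ 2) = √(2 * π) := by
  have hi : Integrable (fun t : ℝ => t ^ 2 * Real.exp (-(1/2) * t ^ 2)) := by
    have := integrable_rpow_mul_exp_neg_mul_sq (b := 1/2) (by norm_num) (s := 2) (by norm_num)
    simpa using this
  have hi1 : Integrable (fun t : ℝ => t * Real.exp (-(1/2) * t ^ 2)) :=
    integrable_mul_exp_neg_mul_sq (by norm_num)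
  refine ⟨hi, ?_⟩
  have hd : ∀ t : ℝ, HasDerivAt (fun t : ℝ => -Real.exp (-(1/2) * t ^ 2))
      (t * Real.exp (-(1/2) * t ^ 2)) t := by
    intro t
    have h1 : HasDerivAt (fun t : ℝ => -(1/2) * t ^ 2) (-(1/2) * (2 * t)) t := by
      simpa using (hasDerivAt_pow 2 t).const_mul (-(1/2 : ℝ))
    have h2 := h1.exp.fun_neg
    exact h2.congr_deriv (by ring)
  have := integral_mul_deriv_eq_deriv_mul_of_integrable (u := fun t : ℝ => t) (u' := fun _ => 1)
    (v := fun t => -Real.exp (-(1/2) * t ^ 2)) (v' := fun t => t * Real.exp (-(1/2) * t ^ 2))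
    (fun t _ => hasDerivAt_id t) (fun t _ => hd t) ?_ ?_ ?_
  · rw [← gauss0.2]
    calc _ = ∫ t : ℝ, t * (t * Real.exp (-(1/2) * t ^ 2)) := by congr 1; funext t; ring
      _ = _ := by rw [this]; simp [integral_neg]
  · refine hi.congr (Eventually.of_forall fun t => ?_)
    simp only [Pi.mul_apply]; ring
  · refine gauss0.1.neg.congr (Eventually.of_forall fun t => ?_)
    simp
  · refine hi1.neg.congr (Eventually.of_forall fun t => ?_)
    simp

/-- truncated gaussian -/
def tg (R : ℝ) (t : ℝ) : ℝ := (Set.Icc (-R) R).indicator (fun t : ℝ => Real.exp (-(1/2) * t ^ 2)) t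

lemma tg_meas (R : ℝ) : Measurable (tg R) := by
  refine Measurable.indicator ?_ measurableSet_Icc
  fun_prop

lemma tg_lim0 : Tendsto (fun k : ℕ => ∫ t, tg k t) atTop (𝓝 √(2 * π)) := by
  have hc : AECover volume atTop (fun k : ℕ => Set.Icc (-(k:ℝ)) k) :=
    aecover_Icc (tendsto_neg_atTop_atBot.comp tendsto_natCast_atTop_atTop) tendsto_natCast_atTop_atTop
  have := hc.integral_tendsto_of_countably_generated gauss0.1
  rw [gauss0.2] at this
  refine this.congr fun k => ?_
  rw [← integral_indicator measurableSet_Icc]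
  rfl

lemma tg_lim2 : Tendsto (fun k : ℕ => ∫ t, t ^ 2 * tg k t) atTop (𝓝 √(2 * π)) := by
  have hc : AECover volume atTop (fun k : ℕ => Set.Icc (-(k:ℝ)) k) :=
    aecover_Icc (tendsto_neg_atTop_atBot.comp tendsto_natCast_atTop_atTop) tendsto_natCast_atTop_atTop
  have := hc.integral_tendsto_of_countably_generated gauss2.1
  rw [gauss2.2] at this
  refine this.congr fun k => ?_
  rw [← integral_indicator measurableSet_Icc]
  congr 1
  funext t
  unfold tg
  by_cases ht : t ∈ Set.Icc (-(k:ℝ)) k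
  · simp [ht]
  · simp [ht]

lemma exists_g {δ : ℝ} (hδ : 0 < δ) : ∃ R : ℝ, 0 ≤ R ∧ ∀ ε : ℝ, 0 < ε → ∃ (g : ℝ → ℝ) (C : ℝ),
    Is1 g C (R * √ε) ε ∧
    1 / 2 * Real.log (2 * π * Real.exp 1) + 1 / 2 * Real.log ε - δ ≤ - ∫ t, g t * Real.log (g t) := by
  have hp : 0 < √(2 * π) := by positivity
  have hlim : Tendsto (fun k : ℕ => 1 / 2 * ((∫ t, t ^ 2 * tg k t) / ∫ t, tg k t) +
      Real.log (∫ t, tg k t) - 1 / 2 * Real.log ((∫ t, t ^ 2 * tg k t) / ∫ t, tg k t)) atTop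
      (𝓝 (1 / 2 * (√(2 * π) / √(2 * π)) + Real.log √(2 * π) - 1 / 2 * Real.log (√(2 * π) / √(2 * π)))) := by
    have hm := tg_lim2.div tg_lim0 hp.ne'
    refine Tendsto.sub (Tendsto.add (hm.const_mul _) (tg_lim0.log hp.ne')) ((hm.log ?_).const_mul _)
    positivity
  have hval : 1 / 2 * (√(2 * π) / √(2 * π)) + Real.log √(2 * π) - 1 / 2 * Real.log (√(2 * π) / √(2 * π))
      = 1 / 2 * Real.log (2 * π * Real.exp 1) := by
    rw [div_self hp.ne', Real.log_one, Real.log_sqrt (by positivity),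
      Real.log_mul (by positivity) (Real.exp_ne_zero _), Real.log_exp]
    ring
  rw [hval] at hlim
  obtain ⟨k, ⟨hk1, hk2⟩, hk3⟩ := ((tg_lim0.eventually_const_lt hp).and (tg_lim2.eventually_const_lt hp)
    |>.and (hlim.eventually_const_lt (show 1 / 2 * Real.log (2 * π * Real.exp 1) - δ < _ by linarith))).exists
  set Z := ∫ t, tg k t with hZ
  set N := ∫ t, t ^ 2 * tg k t with hN
  set m := N / Z with hm
  have hm0 : 0 < m := div_pos hk2 hk1
  refine ⟨k / √m, by positivity, fun ε hε => ?_⟩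
  set s := √ε / √m with hs
  have hs0 : 0 < s := by positivity
  have hs2 : s ^ 2 * m = ε := by
    rw [hs, div_pow, Real.sq_sqrt hε.le, Real.sq_sqrt hm0.le]; field_simp
  have hcomp : ∀ f : ℝ → ℝ, ∫ t, f (t / s) = s * ∫ t, f t := by
    intro f
    rw [Measure.integral_comp_div, abs_of_pos hs0, smul_eq_mul]
  have hn : ∀ t, 0 ≤ tg k t := fun t => Set.indicator_nonneg (fun _ _ => (Real.exp_pos _).le) _
  have h1 : ∫ t, tg k (t / s) / (Z * s) = 1 := by
    rw [integral_div, hcomp, ← hZ]; field_simp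
  have h2 : ∫ t, t ^ 2 * (tg k (t / s) / (Z * s)) = ε := by
    have : ∀ t, t ^ 2 * (tg k (t / s) / (Z * s)) = (s / Z) * ((t / s) ^ 2 * tg k (t / s)) := by
      intro t; field_simp
    simp_rw [this]
    rw [integral_const_mul, hcomp (fun t => t ^ 2 * tg k t), ← hN, ← hs2, hm]
    field_simp
  refine ⟨fun t => tg k (t / s) / (Z * s), 1 / (Z * s), ⟨?_, ?_, ?_, ?_, ?_, ?_, h1, h2⟩, ?_⟩
  · have := tg_meas k
    fun_prop
  · intro t
    exact div_nonneg (hn _) (by positivity)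
  · intro t
    refine div_le_div_of_nonneg_right ?_ (by positivity)
    unfold tg
    refine Set.indicator_le' (fun t _ => ?_) (fun _ _ => zero_le_one) _
    rw [Real.exp_le_one_iff]
    nlinarith [sq_nonneg t]
  · intro t ht
    have : tg k (t / s) = 0 := by
      refine Set.indicator_of_notMem ?_ _
      rw [Set.mem_Icc, ← abs_le, abs_div, abs_of_pos hs0, div_le_iff₀ hs0]
      push Not
      have e : (k:ℝ) * s = k / √m * √ε := by rw [hs]; ring
      rw [e]
      exact ht
    simp [this]
  · intro t
    have : tg k (-t / s) = tg k (t / s) := by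
      unfold tg Set.indicator
      have : (-t / s ∈ Set.Icc (-(k:ℝ)) k) ↔ (t / s ∈ Set.Icc (-(k:ℝ)) k) := by
        rw [Set.mem_Icc, Set.mem_Icc, ← abs_le, ← abs_le, neg_div, abs_neg]
      rw [neg_div] at this ⊢
      simp only [this, even_two, Even.neg_pow]
    simp only [this]
  · positivity
  · have hpt : ∀ t, (tg k (t / s) / (Z * s)) * Real.log (tg k (t / s) / (Z * s)) =
        -(1 / (2 * s ^ 2)) * (t ^ 2 * (tg k (t / s) / (Z * s))) -
          Real.log (Z * s) * (tg k (t / s) / (Z * s)) := by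
      intro t
      by_cases ht : t / s ∈ Set.Icc (-(k:ℝ)) k
      · have : tg k (t / s) = Real.exp (-(1/2) * (t / s) ^ 2) := Set.indicator_of_mem ht _
        rw [this, Real.log_div (Real.exp_ne_zero _) (by positivity), Real.log_exp]
        field_simp
      · have : tg k (t / s) = 0 := Set.indicator_of_notMem ht _
        simp [this]
    have hi1 : Integrable fun t => tg k (t / s) / (Z * s) := by
      by_contra hc
      rw [integral_undef hc] at h1
      exact zero_ne_one h1
    have hi2 : Integrable fun t => t ^ 2 * (tg k (t / s) / (Z * s)) := by
      by_contra hc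
      rw [integral_undef hc] at h2
      exact hε.ne h2
    simp_rw [hpt]
    rw [integral_sub (hi2.const_mul _) (hi1.const_mul _), integral_const_mul, integral_const_mul, h1, h2,
      Real.log_mul hk1.ne' hs0.ne']
    have hls : Real.log s = 1 / 2 * Real.log ε - 1 / 2 * Real.log m := by
      rw [hs, Real.log_div (by positivity) (by positivity), Real.log_sqrt hε.le, Real.log_sqrt hm0.le]
      ring
    have hm2 : 1 / (2 * s ^ 2) * ε = 1 / 2 * m := by
      rw [← hs2]; field_simp
    rw [hls]
    linarith


lemma integral_comp_mat {m : ℕ} {S : Matrix (Fin m) (Fin m) ℝ} (hS : S.det ≠ 0)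
    {f : (Fin m → ℝ) → ℝ} (hf : Measurable f) :
    ∫ x, f (S.mulVec x) = |S.det⁻¹| * ∫ y, f y := by
  have h := Real.map_matrix_volume_pi_eq_smul_volume_pi hS
  have h2 : ∫ y, f y ∂(Measure.map (toLin' S) volume) = ∫ x, f (toLin' S x) := by
    refine integral_map ?_ hf.aestronglyMeasurable
    exact (LinearMap.continuous_of_finiteDimensional _).aemeasurable
  rw [h, integral_smul_measure, ENNReal.toReal_ofReal (abs_nonneg _), smul_eq_mul] at h2
  rw [h2]
  rfl

open scoped MatrixOrder in
lemma exists_factor {m : ℕ} {M : Matrix (Fin m) (Fin m) ℝ} (hM : M.PosDef) :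
    ∃ T : Matrix (Fin m) (Fin m) ℝ, T.det ≠ 0 ∧ M = T * Tᵀ := by
  obtain ⟨B, hB⟩ := CStarAlgebra.nonneg_iff_eq_star_mul_self.mp hM.posSemidef.nonneg
  have hB : M = Bᵀ * B := by
    rw [hB, star_eq_conjTranspose]
    simp
  refine ⟨Bᵀ, ?_, by simpa using hB⟩
  have := hM.det_pos
  rw [hB, det_mul] at this
  intro h0
  rw [det_transpose] at h0
  simp [h0] at this

lemma exists_B_of_posDef {m : ℕ} {M : Matrix (Fin m) (Fin m) ℝ} (hM : M.PosDef) :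
    ∃ (ρ : (Fin m → ℝ) → ℝ) (C R : ℝ), IsB ρ C R ∧ momMatrix ρ = M := by
  obtain ⟨T, hT, rfl⟩ := exists_factor hM
  obtain ⟨R0, hR0, hg⟩ := exists_g one_pos
  obtain ⟨g, C0, hg, -⟩ := hg 1 one_pos
  set u : (Fin m → ℝ) → ℝ := fun w => ∏ i, g (w i) with hu
  have hB := prod_isB hg m
  have hmom := prod_mom hg m
  rw [← hu] at hB hmom
  have hTu : IsUnit T.det := isUnit_iff_ne_zero.2 hT
  have hS : (T⁻¹).det ≠ 0 := by
    rw [det_nonsing_inv, Ring.inverse_eq_inv']; exact inv_ne_zero hT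
  have hdet : |(T⁻¹).det⁻¹| = |T.det| := by
    rw [det_nonsing_inv, Ring.inverse_eq_inv', inv_inv]
  have hTT : ∀ x, T.mulVec (T⁻¹.mulVec x) = x := by
    intro x
    rw [mulVec_mulVec, mul_nonsing_inv _ hTu, one_mulVec]
  have hd0 : 0 < |T.det| := abs_pos.2 hT
  set K := ‖LinearMap.toContinuousLinearMap (toLin' T)‖ with hK
  refine ⟨fun x => |T.det|⁻¹ * u (T⁻¹.mulVec x), |T.det|⁻¹ * C0 ^ m, K * (R0 * √1), ⟨?_, ?_, ?_, ?_, ?_⟩, ?_⟩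
  · refine (hB.1.comp ?_).const_mul _
    exact (LinearMap.continuous_of_finiteDimensional (toLin' T⁻¹)).measurable
  · exact fun x => mul_nonneg (by positivity) (hB.2.1 _)
  · exact fun x => mul_le_mul_of_nonneg_left (hB.2.2.1 _) (by positivity)
  · intro x hx
    have h1 : ‖x‖ ≤ K * ‖T⁻¹.mulVec x‖ := by
      have := (LinearMap.toContinuousLinearMap (toLin' T)).le_opNorm (T⁻¹.mulVec x)
      simpa [hTT] using this
    have h2 := lt_of_mul_lt_mul_left (hx.trans_le h1) (norm_nonneg _)
    show |T.det|⁻¹ * u (T⁻¹.mulVec x) = 0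
    rw [hB.2.2.2.1 _ h2, mul_zero]
  · rw [integral_const_mul, integral_comp_mat hS hB.1, hdet, hB.2.2.2.2]
    field_simp
  · ext i j
    simp only [momMatrix, of_apply]
    have e : ∀ x : Fin m → ℝ, x i * x j * (|T.det|⁻¹ * u (T⁻¹.mulVec x)) =
        |T.det|⁻¹ * ((fun y => (y ⬝ᵥ (vecMulVec (T i) (T j)).mulVec y) * u y) (T⁻¹.mulVec x)) := by
      intro x
      have : ∀ y, y ⬝ᵥ (vecMulVec (T i) (T j)).mulVec y = (T.mulVec y) i * (T.mulVec y) j := by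
        intro y
        rw [quad_eq]
        simp only [vecMulVec_apply, mulVec, dotProduct, Finset.sum_mul_sum]
        refine Finset.sum_congr rfl fun k _ => Finset.sum_congr rfl fun l _ => by ring
      simp only [this, hTT]
      ring
    simp_rw [e]
    rw [integral_const_mul, integral_comp_mat hS (f := fun y => (y ⬝ᵥ (vecMulVec (T i) (T j)).mulVec y) * u y), hdet,
      (integral_quad hB.good.2.2.2.1 _).2, hmom]
    · rw [← mul_assoc, inv_mul_cancel₀ hd0.ne', one_mul, mul_apply]
      simp [pairM, vecMulVec_apply, one_apply]
    · refine Measurable.mul ?_ hB.1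
      simp_rw [quad_eq]
      fun_prop

/-- matrices with positive quadratic form -/
def Dset (m : ℕ) : Set (Matrix (Fin m) (Fin m) ℝ) := {M | ∀ x : Fin m → ℝ, x ≠ 0 → 0 < x ⬝ᵥ M.mulVec x}

/-- symmetric part -/
def symP {m : ℕ} (M : Matrix (Fin m) (Fin m) ℝ) : Matrix (Fin m) (Fin m) ℝ := (1 / 2 : ℝ) • (M + Mᵀ)

lemma symP_posDef {m : ℕ} {M : Matrix (Fin m) (Fin m) ℝ} (h : M ∈ Dset m) : (symP M).PosDef := by
  refine PosDef.of_dotProduct_mulVec_pos ?_ ?_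
  · unfold symP
    ext i j
    simp [add_comm]
    try ring
  · intro x hx
    have h1 := h x hx
    have : x ⬝ᵥ (Mᵀ).mulVec x = x ⬝ᵥ M.mulVec x := by
      rw [mulVec_transpose, dotProduct_comm, dotProduct_mulVec]
    simp only [symP, star_trivial, smul_mulVec, add_mulVec, dotProduct_smul, dotProduct_add, this,
      smul_eq_mul]
    linarith

lemma Dset_isOpen (m : ℕ) : IsOpen (Dset m) := by
  rw [isOpen_iff_mem_nhds]
  intro M hM
  have hc : Continuous fun z : Matrix (Fin m) (Fin m) ℝ × (Fin m → ℝ) => z.2 ⬝ᵥ z.1.mulVec z.2 := by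
    fun_prop
  have := (isCompact_sphere (0 : Fin m → ℝ) 1).eventually_forall_of_forall_eventually (x₀ := M)
    (P := fun N x => 0 < x ⬝ᵥ N.mulVec x) (by
      intro y hy
      have hy0 : y ≠ 0 := by
        rintro rfl
        simp at hy
      exact hc.continuousAt.eventually_const_lt (hM y hy0))
  filter_upwards [this] with N hN x hx
  have hx' : 0 < ‖x‖ := norm_pos_iff.2 hx
  have h1 := hN (‖x‖⁻¹ • x) (by simp [norm_smul, hx'.ne'])
  rw [mulVec_smul, dotProduct_smul, smul_dotProduct, smul_eq_mul, smul_eq_mul] at h1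
  have h2 : 0 < ‖x‖⁻¹ := by positivity
  exact (mul_pos_iff_of_pos_left h2).1 ((mul_pos_iff_of_pos_left h2).1 h1)

lemma Dset_of_posDef {m : ℕ} {M : Matrix (Fin m) (Fin m) ℝ} (h : M.PosDef) : M ∈ Dset m := by
  intro x hx
  simpa using h.dotProduct_mulVec_pos hx

lemma Dset_convex (m : ℕ) : Convex ℝ (Dset m) := by
  intro M hM N hN a b ha hb hab x hx
  have h1 := hM x hx
  have h2 := hN x hx
  simp only [smul_mulVec, add_mulVec, dotProduct_smul, dotProduct_add, smul_eq_mul]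
  rcases ha.eq_or_lt with rfl | ha
  · have : b = 1 := by linarith
    subst this; linarith
  · nlinarith [mul_pos ha h1, mul_nonneg hb h2.le]

lemma mom_mem_Dset {m : ℕ} {ρ : (Fin m → ℝ) → ℝ} (h : IsGoodDensity ρ) : momMatrix ρ ∈ Dset m := by
  intro x hx
  have hρ := good_integrable h
  obtain ⟨hq1, hq2⟩ := integral_quad h.2.2.2.1 (vecMulVec x x)
  have e : pairM (vecMulVec x x) (momMatrix ρ) = x ⬝ᵥ (momMatrix ρ).mulVec x := by
    rw [quad_eq]
    unfold pairM
    refine Finset.sum_congr rfl fun k _ => Finset.sum_congr rfl fun l _ => ?_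
    rw [vecMulVec_apply]; ring
  have e2 : ∀ y : Fin m → ℝ, y ⬝ᵥ (vecMulVec x x).mulVec y = (x ⬝ᵥ y) ^ 2 := by
    intro y
    rw [quad_eq, sq]
    simp only [vecMulVec_apply, dotProduct, Finset.sum_mul_sum]
    refine Finset.sum_congr rfl fun k _ => Finset.sum_congr rfl fun l _ => by ring
  rw [e] at hq2
  rw [← hq2]
  have hnn : 0 ≤ fun y : Fin m → ℝ => (y ⬝ᵥ (vecMulVec x x).mulVec y) * ρ y := by
    intro y
    have := h.2.1 y
    simp only [e2, Pi.zero_apply]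
    positivity
  refine lt_of_le_of_ne (integral_nonneg hnn) fun h0 => ?_
  have hz := (integral_eq_zero_iff_of_nonneg hnn hq1).1 h0.symm
  let L : (Fin m → ℝ) →ₗ[ℝ] ℝ :=
    { toFun := fun y => x ⬝ᵥ y
      map_add' := fun a b => by simp
      map_smul' := fun c a => by simp }
  have hker : volume (LinearMap.ker L : Set (Fin m → ℝ)) = 0 := by
    refine Measure.addHaar_submodule _ _ ?_
    intro ht
    have : x ∈ LinearMap.ker L := by rw [ht]; trivial
    have h3 : x ⬝ᵥ x = 0 := this
    exact hx (dotProduct_self_eq_zero.1 h3)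
  have hae : ∀ᵐ y : Fin m → ℝ, ρ y = 0 := by
    have hn : ∀ᵐ y : Fin m → ℝ, y ∉ (LinearMap.ker L : Set (Fin m → ℝ)) :=
      measure_eq_zero_iff_ae_notMem.1 hker
    filter_upwards [hz, hn] with y h1 h2
    simp only [e2, Pi.zero_apply, mul_eq_zero] at h1
    rcases h1 with h1 | h1
    · exact absurd (show L y = 0 from pow_eq_zero_iff (two_ne_zero) |>.1 h1) h2
    · exact h1
  have : ∫ y, ρ y = 0 := integral_eq_zero_of_ae hae
  rw [h.2.2.1] at this
  exact one_ne_zero this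

lemma symP_mom {m : ℕ} (ρ : (Fin m → ℝ) → ℝ) : symP (momMatrix ρ) = momMatrix ρ := by
  ext i j
  have : ∀ i j, momMatrix ρ i j = momMatrix ρ j i := by
    intro i j
    simp only [momMatrix, of_apply]
    congr 1; funext x; ring
  simp only [symP, Matrix.smul_apply, Matrix.add_apply, transpose_apply, this j i, smul_eq_mul]
  ring

lemma symP_posDef_eq {m : ℕ} {M : Matrix (Fin m) (Fin m) ℝ} (h : M.PosDef) : symP M = M := by
  ext i j
  have := h.isHermitian.apply i j
  simp only [star_trivial] at this
  simp only [symP, Matrix.smul_apply, Matrix.add_apply, transpose_apply, this, smul_eq_mul]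
  ring

/-- value -/
def val {m : ℕ} (U : (Fin m → ℝ) → ℝ) (ρ : (Fin m → ℝ) → ℝ) : ℝ := entropy ρ - ∫ x, U x * ρ x

/-- values of compactly supported bounded densities -/
def valset {m : ℕ} (U : (Fin m → ℝ) → ℝ) (M : Matrix (Fin m) (Fin m) ℝ) : Set ℝ :=
  {r | ∃ ρ C R, IsB ρ C R ∧ momMatrix ρ = M ∧ r = val U ρ}

lemma mix {m : ℕ} {U : (Fin m → ℝ) → ℝ} (hU : Continuous U) {ρ σ : (Fin m → ℝ) → ℝ}
    {C C' R R' : ℝ} (h : IsB ρ C R) (h' : IsB σ C' R') {a b : ℝ} (ha : 0 ≤ a) (hb : 0 ≤ b)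
    (hab : a + b = 1) :
    IsB (fun x => a * ρ x + b * σ x) (a * C + b * C') (max R R') ∧
    momMatrix (fun x => a * ρ x + b * σ x) = a • momMatrix ρ + b • momMatrix σ ∧
    a * val U ρ + b * val U σ ≤ val U (fun x => a * ρ x + b * σ x) := by
  have hB : IsB (fun x => a * ρ x + b * σ x) (a * C + b * C') (max R R') := by
    refine ⟨(h.1.const_mul _).add (h'.1.const_mul _), ?_, ?_, ?_, ?_⟩
    · intro x
      have := h.2.1 x
      have := h'.2.1 x
      positivity
    · intro x
      exact add_le_add (mul_le_mul_of_nonneg_left (h.2.2.1 x) ha)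
        (mul_le_mul_of_nonneg_left (h'.2.2.1 x) hb)
    · intro x hx
      simp only
      rw [h.2.2.2.1 x ((le_max_left _ _).trans_lt hx), h'.2.2.2.1 x ((le_max_right _ _).trans_lt hx)]
      simp
    · rw [integral_add (h.integrable.const_mul _) (h'.integrable.const_mul _), integral_const_mul,
        integral_const_mul, h.2.2.2.2, h'.2.2.2.2]
      linarith
  have hlin : ∀ f : (Fin m → ℝ) → ℝ, Continuous f → ∫ x, f x * (a * ρ x + b * σ x) =
      (a * ∫ x, f x * ρ x) + b * ∫ x, f x * σ x := by
    intro f hf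
    rw [← integral_const_mul, ← integral_const_mul, ← integral_add ((h.integrable_mul hf).const_mul _)
      ((h'.integrable_mul hf).const_mul _)]
    congr 1; funext x; ring
  refine ⟨hB, ?_, ?_⟩
  · ext i j
    simp only [momMatrix, of_apply, Matrix.add_apply, Matrix.smul_apply, smul_eq_mul]
    rw [hlin (fun x => x i * x j) (by fun_prop)]
  · unfold val entropy
    rw [hlin U hU]
    have : ∫ x, (a * ρ x + b * σ x) * Real.log (a * ρ x + b * σ x) ≤
        ∫ x, (a * (ρ x * Real.log (ρ x)) + b * (σ x * Real.log (σ x))) := by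
      refine integral_mono hB.integrable_log ((h.integrable_log.const_mul _).add
        (h'.integrable_log.const_mul _)) fun x => ?_
      have := Real.convexOn_mul_log.2 (h.2.1 x) (h'.2.1 x) ha hb hab
      simpa using this
    rw [integral_add (h.integrable_log.const_mul _) (h'.integrable_log.const_mul _),
      integral_const_mul, integral_const_mul] at this
    simp only at this ⊢
    linarith

lemma val_le {m : ℕ} {U : (Fin m → ℝ) → ℝ} (hU : SuperQuadratic U) {ρ : (Fin m → ℝ) → ℝ}
    {C R : ℝ} (h : IsB ρ C R) (A : Matrix (Fin m) (Fin m) ℝ) :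
    val U ρ ≤ 1 / 2 * pairM A (momMatrix ρ) + Real.log (Zfun m U A) :=
  gibbs (hU.integrable A) h.good (h.integrable_mul hU.1)

lemma valset_bdd {m : ℕ} {U : (Fin m → ℝ) → ℝ} (hU : SuperQuadratic U)
    (M : Matrix (Fin m) (Fin m) ℝ) : BddAbove (valset U M) := by
  refine ⟨Real.log (Zfun m U 0), ?_⟩
  rintro r ⟨ρ, C, R, hB, -, rfl⟩
  have := val_le hU hB 0
  simpa [pairM] using this

lemma valset_nonempty {m : ℕ} (U : (Fin m → ℝ) → ℝ)
    {M : Matrix (Fin m) (Fin m) ℝ} (hM : M.PosDef) : (valset U M).Nonempty := by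
  obtain ⟨ρ, C, R, hB, h⟩ := exists_B_of_posDef hM
  exact ⟨_, ρ, C, R, hB, h, rfl⟩

lemma Fc_concave {m : ℕ} {U : (Fin m → ℝ) → ℝ} (hU : SuperQuadratic U) :
    ConcaveOn ℝ (Dset m) (fun M => sSup (valset U (symP M))) := by
  refine ⟨Dset_convex m, fun M hM N hN a b ha hb hab => ?_⟩
  refine le_of_forall_pos_le_add fun δ hδ => ?_
  obtain ⟨_, ⟨ρ, C, R, hB, hm, rfl⟩, h1⟩ := exists_lt_of_lt_csSup (valset_nonempty U (symP_posDef hM))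
    (show sSup (valset U (symP M)) - δ < _ by linarith)
  obtain ⟨_, ⟨σ, C', R', hB', hm', rfl⟩, h2⟩ := exists_lt_of_lt_csSup (valset_nonempty U (symP_posDef hN))
    (show sSup (valset U (symP N)) - δ < _ by linarith)
  obtain ⟨k1, k2, k3⟩ := mix hU.1 hB hB' ha hb hab
  have hs : symP (a • M + b • N) = a • symP M + b • symP N := by
    unfold symP
    ext i j
    simp only [Matrix.smul_apply, Matrix.add_apply, transpose_apply, smul_eq_mul]
    ring
  have k4 : val U (fun x => a * ρ x + b * σ x) ≤ sSup (valset U (symP (a • M + b • N))) := by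
    refine le_csSup (valset_bdd hU _) ⟨_, _, _, k1, ?_, rfl⟩
    rw [k2, hs, hm, hm']
  simp only [smul_eq_mul]
  have h1' := mul_le_mul_of_nonneg_left h1.le ha
  have h2' := mul_le_mul_of_nonneg_left h2.le hb
  have : a * δ + b * δ = δ := by rw [← add_mul, hab, one_mul]
  linarith



lemma supp_functional {m : ℕ} {U : (Fin m → ℝ) → ℝ} (hU : SuperQuadratic U)
    {G : Matrix (Fin m) (Fin m) ℝ} (hG : G.PosDef) :
    ∃ A : Matrix (Fin m) (Fin m) ℝ, ∀ M ∈ Dset m,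
      sSup (valset U (symP M)) - 1 / 2 * pairM A M ≤ sSup (valset U G) - 1 / 2 * pairM A G := by
  have hconc := Fc_concave hU
  set F : Matrix (Fin m) (Fin m) ℝ → ℝ := fun M => sSup (valset U (symP M)) with hF
  have hGD := Dset_of_posDef hG
  have hFG : F G = sSup (valset U G) := by simp only [hF, symP_posDef_eq hG]
  have hcont : ContinuousOn F (Dset m) := hconc.continuousOn (Dset_isOpen m)
  set H : Set (Matrix (Fin m) (Fin m) ℝ × ℝ) := {p | p.1 ∈ Dset m ∧ p.2 < F p.1} with hH
  have hHc : Convex ℝ H := hconc.convex_strict_hypograph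
  have hHo : IsOpen H := by
    have h1 : IsOpen ((Prod.fst : Matrix (Fin m) (Fin m) ℝ × ℝ → _) ⁻¹' (Dset m)) :=
      (Dset_isOpen m).preimage continuous_fst
    have h2 : ContinuousOn (fun p : Matrix (Fin m) (Fin m) ℝ × ℝ => F p.1 - p.2)
        ((Prod.fst : Matrix (Fin m) (Fin m) ℝ × ℝ → _) ⁻¹' (Dset m)) :=
      (hcont.comp continuous_fst.continuousOn (fun _ h => h)).sub continuous_snd.continuousOn
    have h3 := h2.isOpen_inter_preimage h1 (isOpen_Ioi (a := (0:ℝ)))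
    convert h3 using 1
    ext p
    simp [hH]
  have hnot : (G, F G) ∉ H := by
    simp [hH]
  obtain ⟨f, hf⟩ := geometric_hahn_banach_open_point hHc hHo hnot
  set c := f (0, 1) with hc
  have hsplit : ∀ M : Matrix (Fin m) (Fin m) ℝ, ∀ t : ℝ, f (M, t) = f (M, 0) + t * c := by
    intro M t
    have : ((M, t) : Matrix (Fin m) (Fin m) ℝ × ℝ) = (M, 0) + t • (0, 1) := by simp
    rw [this, map_add, map_smul, smul_eq_mul]
  have hcpos : 0 < c := by
    have := hf (G, F G - 1) ⟨hGD, by simp⟩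
    rw [hsplit, hsplit G (F G)] at this
    linarith
  have hle : ∀ M ∈ Dset m, f (M, 0) + F M * c ≤ f (G, 0) + F G * c := by
    intro M hM
    refine le_of_forall_pos_le_add fun δ hδ => ?_
    have := hf (M, F M - δ / c) ⟨hM, by simp; positivity⟩
    rw [hsplit, hsplit G (F G), sub_mul, div_mul_cancel₀ _ hcpos.ne'] at this
    linarith
  refine ⟨fun i j => -(2 / c) * f (Matrix.single i j 1, 0), fun M hM => ?_⟩
  have hpair : ∀ M : Matrix (Fin m) (Fin m) ℝ,
      pairM (fun i j => -(2 / c) * f (Matrix.single i j 1, 0)) M = -(2 / c) * f (M, 0) := by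
    intro M
    have e : ((M, 0) : Matrix (Fin m) (Fin m) ℝ × ℝ) =
        ∑ i, ∑ j, M i j • ((Matrix.single i j (1:ℝ), 0) : Matrix (Fin m) (Fin m) ℝ × ℝ) := by
      refine Prod.ext ?_ ?_
      · simp only [Prod.fst_sum, Prod.smul_fst]
        conv_lhs => rw [matrix_eq_sum_single M]
        simp
      · simp [Prod.snd_sum]
    rw [e]
    simp only [map_sum, map_smul, pairM, Finset.mul_sum, smul_eq_mul]
    refine Finset.sum_congr rfl fun i _ => Finset.sum_congr rfl fun j _ => by ring
  rw [hpair, hpair, ← hFG]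
  have h := hle M hM
  show F M - _ ≤ _
  have h1 := div_le_div_of_nonneg_right h hcpos.le
  have e1 : ∀ M, (f (M, 0) + F M * c) / c = F M - 1 / 2 * (-(2 / c) * f (M, 0)) := by
    intro M
    field_simp
    ring
  rw [e1, e1] at h1
  exact h1

lemma trunc_gibbs {m : ℕ} {U : (Fin m → ℝ) → ℝ} (hU : SuperQuadratic U)
    (A : Matrix (Fin m) (Fin m) ℝ) {R : ℝ} (hR : 0 < R) :
    ∃ ρ C, IsB ρ C R ∧ 0 < ∫ x in Metric.closedBall 0 R, gibbsW U A x ∧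
      val U ρ = 1 / 2 * pairM A (momMatrix ρ)
        + Real.log (∫ x in Metric.closedBall 0 R, gibbsW U A x) := by
  set B : Set (Fin m → ℝ) := Metric.closedBall 0 R with hBdef
  have hBm : MeasurableSet B := Metric.isClosed_closedBall.measurableSet
  have hint := hU.integrable A
  have hpos : 0 < ∫ x in B, gibbsW U A x := by
    rw [setIntegral_pos_iff_support_of_nonneg_ae (f := gibbsW U A) (Eventually.of_forall fun x => (Real.exp_pos _).le) hint.integrableOn]
    have : Function.support (gibbsW U A) = Set.univ := by
      ext x; simp [gibbsW, Real.exp_ne_zero]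
    rw [this, Set.univ_inter]
    exact Metric.measure_closedBall_pos _ _ hR
  set Z := ∫ x in B, gibbsW U A x with hZ
  obtain ⟨C, hC⟩ := hU.quad_lower A
  set ρ : (Fin m → ℝ) → ℝ := fun x => B.indicator (fun x => gibbsW U A x / Z) x with hρ
  have hIsB : IsB ρ (Real.exp C / Z) R := by
    refine ⟨((continuous_gibbsW hU.1 A).measurable.div_const _).indicator hBm, ?_, ?_, ?_, ?_⟩
    · exact fun x => Set.indicator_nonneg (fun x _ => div_nonneg (Real.exp_pos _).le hpos.le) x
    · intro x
      refine Set.indicator_le' (f := fun x => gibbsW U A x / Z) (g := fun _ => Real.exp C / Z) (fun x _ => ?_) (fun x _ => by positivity) x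
      refine div_le_div_of_nonneg_right ((hC x).trans ?_) hpos.le
      refine Real.exp_le_exp.2 ?_
      have hs : 0 ≤ ∑ i, x i ^ 2 := Finset.sum_nonneg fun i _ => sq_nonneg _
      linarith
    · intro x hx
      refine Set.indicator_of_notMem ?_ _
      simpa [hBdef] using hx
    · rw [hρ, integral_indicator hBm, integral_div, div_self hpos.ne']
  refine ⟨ρ, _, hIsB, hpos, ?_⟩
  obtain ⟨hq, hq2⟩ := integral_quad hIsB.good.2.2.2.1 A
  have hpt : ∀ x, ρ x * Real.log (ρ x) =
      -(1 / 2) * ((x ⬝ᵥ A.mulVec x) * ρ x) - U x * ρ x - Real.log Z * ρ x := by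
    intro x
    by_cases hx : x ∈ B
    · have : ρ x = gibbsW U A x / Z := Set.indicator_of_mem hx _
      have hl : Real.log (ρ x) = -(1 / 2) * (x ⬝ᵥ A.mulVec x) - U x - Real.log Z := by
        rw [this, gibbsW, Real.log_div (Real.exp_pos _).ne' hpos.ne', Real.log_exp]
      rw [hl]; ring
    · have : ρ x = 0 := Set.indicator_of_notMem hx _
      rw [this]; simp
  unfold val entropy
  simp_rw [hpt]
  have hUi := hIsB.integrable_mul hU.1
  have hd : Integrable fun x => -(1 / 2) * ((x ⬝ᵥ A.mulVec x) * ρ x) - U x * ρ x :=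
    (hq.const_mul _).sub hUi
  rw [integral_sub hd (hIsB.integrable.const_mul _),
    integral_sub (hq.const_mul _) hUi, integral_const_mul, integral_const_mul, hq2, hIsB.2.2.2.2]
  ring

lemma strong_dual {m : ℕ} {U : (Fin m → ℝ) → ℝ} (hU : SuperQuadratic U)
    {G : Matrix (Fin m) (Fin m) ℝ} (hG : G.PosDef) :
    ∃ A : Matrix (Fin m) (Fin m) ℝ,
      1 / 2 * pairM A G + Real.log (Zfun m U A) ≤ sSup (valset U G) := by
  obtain ⟨A, hA⟩ := supp_functional hU hG
  refine ⟨A, ?_⟩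
  have hint := hU.integrable A
  have hlim : Tendsto (fun R : ℝ => ∫ x in Metric.closedBall 0 R, gibbsW U A x) atTop
      (𝓝 (Zfun m U A)) :=
    (aecover_closedBall tendsto_id).integral_tendsto_of_countably_generated hint
  have hlog := (Real.continuousAt_log (Z_pos hint).ne').tendsto.comp hlim
  have hle : ∀ᶠ R : ℝ in atTop, Real.log (∫ x in Metric.closedBall 0 R, gibbsW U A x) ≤
      sSup (valset U G) - 1 / 2 * pairM A G := by
    filter_upwards [eventually_gt_atTop 0] with R hR
    obtain ⟨ρ, C, hB, -, hv⟩ := trunc_gibbs hU A hR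
    have h1 := hA _ (mom_mem_Dset hB.good)
    rw [symP_mom] at h1
    have h2 : val U ρ ≤ sSup (valset U (momMatrix ρ)) :=
      le_csSup (valset_bdd hU _) ⟨ρ, C, R, hB, rfl, rfl⟩
    linarith
  have := le_of_tendsto hlog hle
  linarith

lemma Ffun_le {m : ℕ} {U : (Fin m → ℝ) → ℝ} (hU : SuperQuadratic U)
    {G : Matrix (Fin m) (Fin m) ℝ} (hG : G.PosDef) (A : Matrix (Fin m) (Fin m) ℝ) :
    Ffun m U G ≤ 1 / 2 * pairM A G + Real.log (Zfun m U A) := by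
  refine csSup_le ?_ ?_
  · obtain ⟨ρ, C, R, hB, h⟩ := exists_B_of_posDef hG
    exact ⟨_, ρ, hB.good, hB.integrable_mul hU.1, h, rfl⟩
  · rintro r ⟨ρ, h1, h2, h3, rfl⟩
    rw [← h3]
    exact gibbs (hU.integrable A) h1 h2

lemma le_Ffun {m : ℕ} {U : (Fin m → ℝ) → ℝ} (hU : SuperQuadratic U)
    {ρ : (Fin m → ℝ) → ℝ} {C R : ℝ} (h : IsB ρ C R) : val U ρ ≤ Ffun m U (momMatrix ρ) := by
  refine le_csSup ⟨Real.log (Zfun m U 0), ?_⟩ ⟨ρ, h.good, h.integrable_mul hU.1, rfl, rfl⟩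
  rintro r ⟨ρ, h1, h2, h3, rfl⟩
  have := gibbs (hU.integrable 0) h1 h2
  simpa [pairM] using this

lemma dual_attained {m : ℕ} {U : (Fin m → ℝ) → ℝ} (hU : SuperQuadratic U)
    {G : Matrix (Fin m) (Fin m) ℝ} (hG : G.PosDef) :
    ∃ A : Matrix (Fin m) (Fin m) ℝ,
      1 / 2 * pairM A G + Real.log (Zfun m U A) = Ffun m U G := by
  obtain ⟨A, hA⟩ := strong_dual hU hG
  refine ⟨A, le_antisymm (hA.trans ?_) (Ffun_le hU hG A)⟩
  refine csSup_le (valset_nonempty U hG) ?_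
  rintro r ⟨ρ, C, R, hB, rfl, rfl⟩
  exact le_Ffun hU hB

lemma exists_approx {m : ℕ} {U : (Fin m → ℝ) → ℝ} (hU : SuperQuadratic U)
    {G : Matrix (Fin m) (Fin m) ℝ} (hG : G.PosDef) {δ : ℝ} (hδ : 0 < δ) :
    ∃ ρ C R, IsB ρ C R ∧ momMatrix ρ = G ∧ Ffun m U G - δ ≤ val U ρ := by
  obtain ⟨A, hA⟩ := strong_dual hU hG
  have h1 := (Ffun_le hU hG A).trans hA
  obtain ⟨_, ⟨ρ, C, R, hB, hm, rfl⟩, h2⟩ := exists_lt_of_lt_csSup (valset_nonempty U hG)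
    (show sSup (valset U G) - δ < _ by linarith)
  exact ⟨ρ, C, R, hB, hm, by linarith⟩


/-- first coordinates -/
def yp {p q : ℕ} (x : Fin (p + q) → ℝ) : Fin p → ℝ := fun i => x (Fin.castAdd q i)
/-- last coordinates -/
def zp {p q : ℕ} (x : Fin (p + q) → ℝ) : Fin q → ℝ := fun j => x (Fin.natAdd p j)

/-- gluing coordinates -/
def eap (p q : ℕ) : (Fin p → ℝ) × (Fin q → ℝ) ≃ᵐ (Fin (p + q) → ℝ) :=
  (MeasurableEquiv.sumPiEquivProdPi (fun _ : Fin p ⊕ Fin q => ℝ)).symm.trans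
    (MeasurableEquiv.piCongrLeft (fun _ : Fin (p + q) => ℝ) finSumFinEquiv)

lemma yp_eap {p q : ℕ} (w : (Fin p → ℝ) × (Fin q → ℝ)) : yp (eap p q w) = w.1 := by
  funext i
  have := MeasurableEquiv.piCongrLeft_apply_apply (finSumFinEquiv (m := p) (n := q))
    (β := fun _ => ℝ) ((MeasurableEquiv.sumPiEquivProdPi (fun _ : Fin p ⊕ Fin q => ℝ)).symm w) (Sum.inl i)
  rw [finSumFinEquiv_apply_left] at this
  exact this

lemma zp_eap {p q : ℕ} (w : (Fin p → ℝ) × (Fin q → ℝ)) : zp (eap p q w) = w.2 := by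
  funext i
  have := MeasurableEquiv.piCongrLeft_apply_apply (finSumFinEquiv (m := p) (n := q))
    (β := fun _ => ℝ) ((MeasurableEquiv.sumPiEquivProdPi (fun _ : Fin p ⊕ Fin q => ℝ)).symm w) (Sum.inr i)
  rw [finSumFinEquiv_apply_right] at this
  exact this

lemma integral_eap {p q : ℕ} (f : (Fin (p + q) → ℝ) → ℝ) :
    ∫ x, f x = ∫ w : (Fin p → ℝ) × (Fin q → ℝ), f (eap p q w) := by
  have h : MeasurePreserving (eap p q) :=
    (volume_measurePreserving_sumPiEquivProdPi_symm (fun _ : Fin p ⊕ Fin q => ℝ)).trans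
      (volume_measurePreserving_piCongrLeft (fun _ : Fin (p + q) => ℝ) finSumFinEquiv)
  exact (h.integral_comp' f).symm

lemma integral_split {p q : ℕ} (f : (Fin p → ℝ) → ℝ) (g : (Fin q → ℝ) → ℝ) :
    ∫ x : Fin (p + q) → ℝ, f (yp x) * g (zp x) = (∫ y, f y) * ∫ z, g z := by
  rw [integral_eap]
  simp_rw [yp_eap, zp_eap]
  exact integral_prod_mul f g

lemma integrable_split {p q : ℕ} {f : (Fin p → ℝ) → ℝ} {g : (Fin q → ℝ) → ℝ} (hf : Integrable f)
    (hg : Integrable g) : Integrable fun x : Fin (p + q) → ℝ => f (yp x) * g (zp x) := by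
  have h : MeasurePreserving (eap p q) :=
    (volume_measurePreserving_sumPiEquivProdPi_symm (fun _ : Fin p ⊕ Fin q => ℝ)).trans
      (volume_measurePreserving_piCongrLeft (fun _ : Fin (p + q) => ℝ) finSumFinEquiv)
  rw [← h.integrable_comp_emb (eap p q).measurableEmbedding]
  have := hf.mul_prod hg
  refine this.congr (Eventually.of_forall fun w => ?_)
  simp [yp_eap, zp_eap]

/-- gluing -/
def ap {p q : ℕ} (y : Fin p → ℝ) (z : Fin q → ℝ) : Fin (p + q) → ℝ := Fin.append y z

@[simp] lemma yp_ap {p q : ℕ} (y : Fin p → ℝ) (z : Fin q → ℝ) : yp (ap y z) = y := by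
  funext i; simp [yp, ap]
@[simp] lemma zp_ap {p q : ℕ} (y : Fin p → ℝ) (z : Fin q → ℝ) : zp (ap y z) = z := by
  funext i; simp [zp, ap]

lemma ap_ext {p q : ℕ} {x x' : Fin (p + q) → ℝ} (h1 : yp x = yp x') (h2 : zp x = zp x') : x = x' := by
  funext i
  refine Fin.addCases (fun i => ?_) (fun j => ?_) i
  · exact congrFun h1 i
  · exact congrFun h2 j

lemma ap_yz {p q : ℕ} (x : Fin (p + q) → ℝ) : ap (yp x) (zp x) = x := by
  refine ap_ext ?_ ?_ <;> simp

@[fun_prop] lemma continuous_yp {p q : ℕ} : Continuous (yp : (Fin (p + q) → ℝ) → _) := by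
  unfold yp; fun_prop
@[fun_prop] lemma continuous_zp {p q : ℕ} : Continuous (zp : (Fin (p + q) → ℝ) → _) := by
  unfold zp; fun_prop

lemma continuous_ap {p q : ℕ} :
    Continuous fun w : (Fin p → ℝ) × (Fin q → ℝ) => ap w.1 w.2 := by
  refine continuous_pi fun i => ?_
  refine Fin.addCases (fun i => ?_) (fun j => ?_) i
  · simp only [ap, Fin.append_left]; fun_prop
  · simp only [ap, Fin.append_right]; fun_prop

lemma norm_ap_le {p q : ℕ} {x : Fin (p + q) → ℝ} {r : ℝ} (h1 : ‖yp x‖ ≤ r) (h2 : ‖zp x‖ ≤ r) :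
    ‖x‖ ≤ r := by
  refine (pi_norm_le_iff_of_nonneg ((norm_nonneg _).trans h1)).2 fun i => ?_
  refine Fin.addCases (fun i => ?_) (fun j => ?_) i
  · exact (norm_le_pi_norm (yp x) i).trans h1
  · exact (norm_le_pi_norm (zp x) j).trans h2

/-- block diagonal -/
def bd {p : ℕ} (q : ℕ) (M : Matrix (Fin p) (Fin p) ℝ) (t : ℝ) : Matrix (Fin (p + q)) (Fin (p + q)) ℝ :=
  reindex finSumFinEquiv finSumFinEquiv (fromBlocks M 0 0 (t • (1 : Matrix (Fin q) (Fin q) ℝ)))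

@[simp] lemma bd_ll {p q : ℕ} (M : Matrix (Fin p) (Fin p) ℝ) (t : ℝ) (i j : Fin p) :
    bd q M t (Fin.castAdd q i) (Fin.castAdd q j) = M i j := by simp [bd]
@[simp] lemma bd_lr {p q : ℕ} (M : Matrix (Fin p) (Fin p) ℝ) (t : ℝ) (i : Fin p) (j : Fin q) :
    bd q M t (Fin.castAdd q i) (Fin.natAdd p j) = 0 := by simp [bd]
@[simp] lemma bd_rl {p q : ℕ} (M : Matrix (Fin p) (Fin p) ℝ) (t : ℝ) (i : Fin p) (j : Fin q) :
    bd q M t (Fin.natAdd p j) (Fin.castAdd q i) = 0 := by simp [bd]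
@[simp] lemma bd_rr {p q : ℕ} (M : Matrix (Fin p) (Fin p) ℝ) (t : ℝ) (i j : Fin q) :
    bd q M t (Fin.natAdd p i) (Fin.natAdd p j) = if i = j then t else 0 := by
  simp [bd, Matrix.one_apply]

lemma bd_det {p q : ℕ} (M : Matrix (Fin p) (Fin p) ℝ) (t : ℝ) : (bd q M t).det = M.det * t ^ q := by
  unfold bd
  rw [det_reindex_self, det_fromBlocks_zero₂₁, det_smul, det_one]
  simp

lemma bd_quad {p q : ℕ} (M : Matrix (Fin p) (Fin p) ℝ) (t : ℝ) (x : Fin (p + q) → ℝ) :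
    x ⬝ᵥ (bd q M t).mulVec x = yp x ⬝ᵥ M.mulVec (yp x) + t * ∑ j, zp x j ^ 2 := by
  rw [quad_eq, quad_eq]
  simp only [Fin.sum_univ_add, bd_ll, bd_lr, bd_rl, bd_rr, zero_mul, Finset.sum_const_zero,
    add_zero, zero_add, ite_mul, Finset.sum_ite_eq, Finset.mem_univ, if_true, Finset.mul_sum]
  congr 1
  refine Finset.sum_congr rfl fun j _ => ?_
  simp only [zp]; ring

lemma bd_pair {p q : ℕ} (M N : Matrix (Fin p) (Fin p) ℝ) (s t : ℝ) :
    pairM (bd q M s) (bd q N t) = pairM M N + q * (s * t) := by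
  unfold pairM
  simp only [Fin.sum_univ_add, bd_ll, bd_lr, bd_rl, bd_rr, zero_mul, Finset.sum_const_zero,
    add_zero, zero_add, ite_mul, mul_ite, mul_zero, Finset.sum_ite_eq, Finset.mem_univ, if_true]
  simp

lemma sum_split {p q : ℕ} (x : Fin (p + q) → ℝ) :
    ∑ i, x i ^ 2 = ∑ i, yp x i ^ 2 + ∑ j, zp x j ^ 2 := by
  rw [Fin.sum_univ_add]; rfl

lemma bd_symm {p q : ℕ} {M : Matrix (Fin p) (Fin p) ℝ} (hM : M.IsHermitian) (t : ℝ) :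
    (bd q M t).IsHermitian := by
  ext i j
  have hh : ∀ i j, M j i = M i j := fun i j => by simpa using hM.apply i j
  refine Fin.addCases (fun i => ?_) (fun i => ?_) i <;>
  refine Fin.addCases (fun j => ?_) (fun j => ?_) j <;>
  simp [hh, eq_comm]

lemma bd_posDef {p q : ℕ} {M : Matrix (Fin p) (Fin p) ℝ} (hM : M.PosDef) {t : ℝ} (ht : 0 < t) :
    (bd q M t).PosDef := by
  refine PosDef.of_dotProduct_mulVec_pos (bd_symm hM.isHermitian t) fun x hx => ?_
  rw [star_trivial, bd_quad]
  have h2 : 0 ≤ ∑ j, zp x j ^ 2 := Finset.sum_nonneg fun _ _ => sq_nonneg _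
  by_cases h : yp x = 0
  · have : 0 < ∑ j, zp x j ^ 2 := by
      refine lt_of_le_of_ne h2 fun h0 => hx ?_
      refine ap_ext h ?_
      funext j
      have := (Finset.sum_eq_zero_iff_of_nonneg (fun _ _ => sq_nonneg _)).1 h0.symm j (Finset.mem_univ _)
      exact pow_eq_zero_iff two_ne_zero |>.1 this
    rw [h]
    simp only [zero_dotProduct, zero_add]
    positivity
  · have := Dset_of_posDef hM _ h
    positivity

lemma bd_posSemidef {p q : ℕ} {M : Matrix (Fin p) (Fin p) ℝ} (hM : M.PosDef) :
    (bd q M 0).PosSemidef := by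
  refine PosSemidef.of_dotProduct_mulVec_nonneg (bd_symm hM.isHermitian 0) fun x => ?_
  rw [star_trivial, bd_quad, zero_mul, add_zero]
  simpa using hM.posSemidef.dotProduct_mulVec_nonneg (yp x)

lemma bd_cont {p q : ℕ} (M : Matrix (Fin p) (Fin p) ℝ) : Continuous fun t => bd q M t := by
  unfold bd
  simp only [reindex_apply]
  fun_prop

/-- scaling of last coordinates -/
def sc {p q : ℕ} (s : ℝ) (x : Fin (p + q) → ℝ) : Fin (p + q) → ℝ := ap (yp x) (s • zp x)

lemma sc_eq {p q : ℕ} (s : ℝ) (x : Fin (p + q) → ℝ) :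
    (bd q (1 : Matrix (Fin p) (Fin p) ℝ) s).mulVec x = sc s x := by
  refine ap_ext ?_ ?_
  · funext i
    simp only [yp, mulVec, dotProduct, Fin.sum_univ_add, bd_ll, bd_lr, sc]
    simp [Matrix.one_apply, ap, yp]
  · funext i
    simp only [zp, mulVec, dotProduct, Fin.sum_univ_add, bd_rl, bd_rr, sc]
    simp [ap, zp]

lemma continuous_sc {p q : ℕ} : Continuous fun w : ℝ × (Fin (p + q) → ℝ) => sc w.1 w.2 := by
  unfold sc
  exact continuous_ap.comp (by fun_prop : Continuous fun w : ℝ × (Fin (p + q) → ℝ) => (yp w.2, w.1 • zp w.2))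

lemma gaussq (q : ℕ) : ∫ z : Fin q → ℝ, Real.exp (-(1/2) * ∑ j, z j ^ 2) = √(2 * π) ^ q := by
  simp_rw [Finset.mul_sum, Real.exp_sum]
  rw [integral_fintype_prod_volume_eq_prod (f := fun (_ : Fin q) t => Real.exp (-(1/2) * t ^ 2))]
  rw [gauss0.2]
  simp

/-- rescaled partition function -/
def Is {p q : ℕ} (U : (Fin (p + q) → ℝ) → ℝ) (A : Matrix (Fin p) (Fin p) ℝ) (s : ℝ) : ℝ :=
  ∫ x, Real.exp (-(1 / 2) * (x ⬝ᵥ (bd q A 1).mulVec x) - U (sc s x))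

lemma Z_scale {p q : ℕ} {U : (Fin (p + q) → ℝ) → ℝ} (hU : Continuous U)
    (A : Matrix (Fin p) (Fin p) ℝ) {s : ℝ} (hs : 0 < s) :
    Zfun (p + q) U (bd q A (s ^ 2)⁻¹) = s ^ q * Is U A s := by
  have hd : (bd q (1 : Matrix (Fin p) (Fin p) ℝ) s).det = s ^ q := by rw [bd_det]; simp
  have h := integral_comp_mat (S := bd q (1 : Matrix (Fin p) (Fin p) ℝ) s) (by rw [hd]; positivity)
    (continuous_gibbsW hU (bd q A (s ^ 2)⁻¹)).measurable
  have e : ∀ x, gibbsW U (bd q A (s ^ 2)⁻¹) ((bd q (1 : Matrix (Fin p) (Fin p) ℝ) s).mulVec x) =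
      Real.exp (-(1 / 2) * (x ⬝ᵥ (bd q A 1).mulVec x) - U (sc s x)) := by
    intro x
    rw [sc_eq, gibbsW, bd_quad, bd_quad]
    congr 4
    · simp [sc]
    · simp only [sc, zp_ap, Pi.smul_apply, smul_eq_mul, mul_pow, ← Finset.mul_sum]
      field_simp
  simp_rw [e] at h
  rw [Is, h, hd, abs_of_pos (by positivity), ← mul_assoc, mul_inv_cancel₀ (by positivity), one_mul]
  rfl

lemma Is_zero {p q : ℕ} (U : (Fin (p + q) → ℝ) → ℝ) (A : Matrix (Fin p) (Fin p) ℝ) :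
    Is U A 0 = Zfun p (fun y => U (ap y 0)) A * √(2 * π) ^ q := by
  rw [← gaussq, Zfun, ← integral_split]
  unfold Is
  congr 1
  funext x
  rw [← Real.exp_add, bd_quad]
  congr 1
  simp only [sc, zero_smul]
  ring

lemma Is_tendsto {p q : ℕ} {U : (Fin (p + q) → ℝ) → ℝ} (hU : SuperQuadratic U)
    (A : Matrix (Fin p) (Fin p) ℝ) : Tendsto (Is U A) (𝓝 0) (𝓝 (Is U A 0)) := by
  obtain ⟨a, ha, hA⟩ := quad_bound A
  obtain ⟨C, hC⟩ := hU.lower (c := a + 1) (by linarith)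
  have hUc := hU.1
  have hc : Continuous fun w : ℝ × (Fin (p + q) → ℝ) =>
      Real.exp (-(1 / 2) * (w.2 ⬝ᵥ (bd q A 1).mulVec w.2) - U (sc w.1 w.2)) := by
    have := hUc.comp (continuous_sc (p := p) (q := q))
    simp_rw [quad_eq]
    exact Real.continuous_exp.comp (Continuous.sub (by fun_prop) this)
  refine tendsto_integral_filter_of_dominated_convergence
    (fun x => Real.exp C * Real.exp (-(1/2) * ∑ i, x i ^ 2)) ?_ ?_ ?_ ?_
  · exact Eventually.of_forall fun s =>
      (hc.comp (Continuous.prodMk_right s)).aestronglyMeasurable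
  · refine Eventually.of_forall fun s => Eventually.of_forall fun x => ?_
    rw [Real.norm_of_nonneg (Real.exp_pos _).le, ← Real.exp_add]
    refine Real.exp_le_exp.2 ?_
    have h1 := abs_le.1 (hA (yp x))
    have h2 := hC (sc s x)
    rw [sum_split] at h2 ⊢
    have hs : 0 ≤ ∑ i, yp x i ^ 2 := Finset.sum_nonneg fun i _ => sq_nonneg _
    have hs2 : 0 ≤ ∑ i, zp (sc s x) i ^ 2 := Finset.sum_nonneg fun i _ => sq_nonneg _
    rw [bd_quad]
    have e : yp (sc s x) = yp x := by simp [sc]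
    rw [e] at h2
    nlinarith [mul_nonneg ha.le hs2, mul_nonneg ha.le hs]
  · exact (integrable_exp_sum (by norm_num)).const_mul _
  · refine Eventually.of_forall fun x => ?_
    exact (hc.comp (Continuous.prodMk_left x)).tendsto 0


lemma up_super {p q : ℕ} {U : (Fin (p + q) → ℝ) → ℝ} (hU : SuperQuadratic U) :
    SuperQuadratic (fun y : Fin p → ℝ => U (ap y (0 : Fin q → ℝ))) := by
  have hc : Continuous fun y : Fin p → ℝ => ap y (0 : Fin q → ℝ) :=
    continuous_ap.comp (by fun_prop : Continuous fun y : Fin p → ℝ => (y, (0 : Fin q → ℝ)))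
  have hn : ∀ y : Fin p → ℝ, ‖ap y (0 : Fin q → ℝ)‖ = ‖y‖ := by
    intro y
    refine le_antisymm (norm_ap_le (by simp) (by simp)) ?_
    refine (pi_norm_le_iff_of_nonneg (norm_nonneg _)).2 fun i => ?_
    have := norm_le_pi_norm (ap y (0 : Fin q → ℝ)) (Fin.castAdd q i)
    simpa [ap] using this
  refine ⟨hU.1.comp hc, fun c hc0 => ?_⟩
  have ht : Tendsto (fun y : Fin p → ℝ => ap y (0 : Fin q → ℝ)) (cocompact _) (cocompact _) := by
    have h1 : Tendsto (fun y : Fin p → ℝ => ‖ap y (0 : Fin q → ℝ)‖) (cocompact _) atTop := by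
      simp_rw [hn]
      exact tendsto_norm_cocompact_atTop
    rw [← Metric.cobounded_eq_cocompact (α := Fin (p + q) → ℝ)]
    exact tendsto_norm_atTop_iff_cobounded.1 h1
  have := (hU.2 c hc0).comp ht
  simpa [Function.comp_def, hn] using this

lemma prodD_isB {p q : ℕ} {ρ : (Fin p → ℝ) → ℝ} {η : (Fin q → ℝ) → ℝ} {C R C' R' : ℝ}
    (h : IsB ρ C R) (h' : IsB η C' R') :
    IsB (fun x : Fin (p + q) → ℝ => ρ (yp x) * η (zp x)) (C * C') (max R R') := by
  have h1 := h.1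
  have h1' := h'.1
  refine ⟨(h1.comp continuous_yp.measurable).mul (h1'.comp continuous_zp.measurable), ?_, ?_, ?_, ?_⟩
  · exact fun x => mul_nonneg (h.2.1 _) (h'.2.1 _)
  · exact fun x => mul_le_mul (h.2.2.1 _) (h'.2.2.1 _) (h'.2.1 _) ((h.2.1 0).trans (h.2.2.1 0))
  · intro x hx
    by_contra hc
    rw [mul_eq_zero, not_or] at hc
    refine absurd (norm_ap_le (x := x) (r := max R R') ?_ ?_) (not_le.2 hx)
    · by_contra hcc
      exact hc.1 (h.2.2.2.1 _ ((le_max_left _ _).trans_lt (not_le.1 hcc)))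
    · by_contra hcc
      exact hc.2 (h'.2.2.2.1 _ ((le_max_right _ _).trans_lt (not_le.1 hcc)))
  · rw [integral_split, h.2.2.2.2, h'.2.2.2.2, one_mul]

lemma prodD_mom {p q : ℕ} {ρ : (Fin p → ℝ) → ℝ} {η : (Fin q → ℝ) → ℝ} {C R C' R' t : ℝ}
    (h : IsB ρ C R) (h' : IsB η C' R') (hη : momMatrix η = t • (1 : Matrix (Fin q) (Fin q) ℝ))
    (hodd : ∀ j, ∫ z, z j * η z = 0) :
    momMatrix (fun x : Fin (p + q) → ℝ => ρ (yp x) * η (zp x)) = bd q (momMatrix ρ) t := by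
  ext i j
  refine Fin.addCases (fun i => ?_) (fun i => ?_) i <;>
  refine Fin.addCases (fun j => ?_) (fun j => ?_) j
  · rw [bd_ll]
    simp only [momMatrix, of_apply]
    have := integral_split (q := q) (fun y : Fin p → ℝ => y i * y j * ρ y) η
    rw [h'.2.2.2.2, mul_one] at this
    rw [← this]
    congr 1; funext x; simp only [yp]; ring
  · rw [bd_lr]
    simp only [momMatrix, of_apply]
    have := integral_split (fun y : Fin p → ℝ => y i * ρ y) (fun z => z j * η z)
    rw [hodd, mul_zero] at this
    rw [← this]
    congr 1; funext x; simp only [yp, zp]; ring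
  · rw [bd_rl]
    simp only [momMatrix, of_apply]
    have := integral_split (fun y : Fin p → ℝ => y j * ρ y) (fun z => z i * η z)
    rw [hodd, mul_zero] at this
    rw [← this]
    congr 1; funext x; simp only [yp, zp]; ring
  · rw [bd_rr]
    have e := congrFun (congrFun hη i) j
    simp only [momMatrix, of_apply, Matrix.smul_apply, Matrix.one_apply, smul_eq_mul, mul_ite,
      mul_one, mul_zero] at e ⊢
    rw [← e]
    have := integral_split ρ (fun z : Fin q → ℝ => z i * z j * η z)
    rw [h.2.2.2.2, one_mul] at this
    rw [← this]
    congr 1; funext x; simp only [zp]; ring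

lemma prodD_entropy {p q : ℕ} {ρ : (Fin p → ℝ) → ℝ} {η : (Fin q → ℝ) → ℝ} {C R C' R' : ℝ}
    (h : IsB ρ C R) (h' : IsB η C' R') :
    entropy (fun x : Fin (p + q) → ℝ => ρ (yp x) * η (zp x)) = entropy ρ + entropy η := by
  unfold entropy
  have e : ∀ x : Fin (p + q) → ℝ, ρ (yp x) * η (zp x) * Real.log (ρ (yp x) * η (zp x)) =
      (fun y => ρ y * Real.log (ρ y)) (yp x) * η (zp x) +
      ρ (yp x) * (fun z => η z * Real.log (η z)) (zp x) := by
    intro x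
    by_cases h0 : ρ (yp x) = 0
    · simp [h0]
    by_cases h1 : η (zp x) = 0
    · simp [h1]
    rw [Real.log_mul h0 h1]
    ring
  simp_rw [e]
  rw [integral_add (integrable_split h.integrable_log h'.integrable)
    (integrable_split h.integrable h'.integrable_log), integral_split (fun y => ρ y * Real.log (ρ y)),
    integral_split ρ (fun z => η z * Real.log (η z)), h.2.2.2.2, h'.2.2.2.2]
  ring

lemma pot_le {p q : ℕ} {U : (Fin (p + q) → ℝ) → ℝ} (hU : Continuous U) {ρ : (Fin p → ℝ) → ℝ}
    {C R : ℝ} (h : IsB ρ C R) {δ : ℝ} (hδ : 0 < δ) :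
    ∃ τ > 0, ∀ (η : (Fin q → ℝ) → ℝ) (C' r : ℝ), IsB η C' r → r < τ →
      ∫ x, U x * (ρ (yp x) * η (zp x)) ≤ (∫ y, U (ap y 0) * ρ y) + δ := by
  have huc := (isCompact_closedBall (0 : Fin (p + q) → ℝ) (max R 1)).uniformContinuousOn_of_continuous
    hU.continuousOn
  obtain ⟨τ, hτ, hd⟩ := Metric.uniformContinuousOn_iff.1 huc δ hδ
  refine ⟨min τ 1, by positivity, fun η C' r h' hr => ?_⟩
  have hB := prodD_isB h h'
  have hc0 : Continuous fun y : Fin p → ℝ => ap y (0 : Fin q → ℝ) :=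
    continuous_ap.comp (by fun_prop : Continuous fun y : Fin p → ℝ => (y, (0 : Fin q → ℝ)))
  have hc : Continuous fun x : Fin (p + q) → ℝ => U (ap (yp x) 0) + δ :=
    ((hU.comp hc0).comp continuous_yp).add continuous_const
  have h1 : ∫ x, U x * (ρ (yp x) * η (zp x)) ≤
      ∫ x, (U (ap (yp x) 0) + δ) * (ρ (yp x) * η (zp x)) := by
    refine integral_mono (hB.integrable_mul hU) (hB.integrable_mul hc) fun x => ?_
    simp only
    by_cases hy : R < ‖yp x‖
    · rw [h.2.2.2.1 _ hy]; simp
    by_cases hz : r < ‖zp x‖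
    · rw [h'.2.2.2.1 _ hz]; simp
    refine mul_le_mul_of_nonneg_right ?_ (hB.2.1 x)
    rw [not_lt] at hy hz
    have hz1 : ‖zp x‖ < 1 := hz.trans_lt (hr.trans_le (min_le_right _ _))
    have hzτ : ‖zp x‖ < τ := hz.trans_lt (hr.trans_le (min_le_left _ _))
    have hxn : ‖x‖ ≤ max R 1 := norm_ap_le (hy.trans (le_max_left _ _)) (hz1.le.trans (le_max_right _ _))
    have hxn0 : ‖ap (yp x) (0 : Fin q → ℝ)‖ ≤ max R 1 :=
      norm_ap_le (by simp [hy]) (by simp)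
    have hdist : dist x (ap (yp x) 0) < τ := by
      rw [dist_eq_norm]
      refine lt_of_le_of_lt (norm_ap_le (r := ‖zp x‖) ?_ ?_) hzτ
      · have : yp (x - ap (yp x) (0 : Fin q → ℝ)) = 0 := by
          funext i; simp [yp, ap]
        rw [this]; simp
      · have : zp (x - ap (yp x) (0 : Fin q → ℝ)) = zp x := by
          funext i; simp [zp, ap]
        rw [this]
    have := hd x (by simpa using hxn) _ (by simpa using hxn0) hdist
    rw [Real.dist_eq] at this
    linarith [(abs_lt.1 this).2]
  refine h1.trans (le_of_eq ?_)
  have e : ∀ x : Fin (p + q) → ℝ, (U (ap (yp x) 0) + δ) * (ρ (yp x) * η (zp x)) =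
      (fun y : Fin p → ℝ => U (ap y 0) * ρ y + δ * ρ y) (yp x) * η (zp x) := by
    intro x; simp only; ring
  simp_rw [e]
  rw [integral_split (fun y : Fin p → ℝ => U (ap y 0) * ρ y + δ * ρ y), h'.2.2.2.2,
    integral_add (h.integrable_mul (f := fun y : Fin p → ℝ => U (ap y 0)) (hU.comp hc0)) (h.integrable.const_mul _), integral_const_mul,
    h.2.2.2.2]
  ring

lemma lower_bound {p q : ℕ} {U : (Fin (p + q) → ℝ) → ℝ} (hU : SuperQuadratic U)
    {G : Matrix (Fin p) (Fin p) ℝ} (hG : G.PosDef) {δ : ℝ} (hδ : 0 < δ) :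
    ∀ᶠ s in 𝓝[>] (0:ℝ), Ffun p (fun y => U (ap y 0)) G - 2 * δ
      + q * (1 / 2 * Real.log (2 * π * Real.exp 1) + Real.log s - δ) ≤ Ffun (p + q) U (bd q G (s ^ 2)) := by
  obtain ⟨ρ, C, R, hB, hm, hv⟩ := exists_approx (up_super hU) hG hδ
  obtain ⟨R0, hR0, hg⟩ := exists_g hδ
  obtain ⟨τ, hτ, hpot⟩ := pot_le hU.1 hB hδ
  have hev : ∀ᶠ s in 𝓝[>] (0:ℝ), R0 * s < τ := by
    have : Tendsto (fun s : ℝ => R0 * s) (𝓝[>] 0) (𝓝 (R0 * 0)) :=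
      (tendsto_id.const_mul R0).mono_left nhdsWithin_le_nhds
    rw [mul_zero] at this
    exact this.eventually_lt_const hτ
  filter_upwards [hev, self_mem_nhdsWithin] with s hs hs0
  have hs0 : 0 < s := hs0
  obtain ⟨g, C', hI, he⟩ := hg (s ^ 2) (by positivity)
  rw [Real.sqrt_sq hs0.le] at hI
  have hη := prod_isB hI q
  have hp1 := hpot _ _ _ hη hs
  have hodd : ∀ j, ∫ z : Fin q → ℝ, z j * ∏ i, g (z i) = 0 := by
    intro j
    have h1 := integral_neg_eq_self (fun z : Fin q → ℝ => z j * ∏ i, g (z i)) volume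
    have h2 : ∫ z : Fin q → ℝ, (-z) j * ∏ i, g ((-z) i) = - ∫ z : Fin q → ℝ, z j * ∏ i, g (z i) := by
      rw [← integral_neg]
      congr 1
      funext z
      simp only [Pi.neg_apply, hI.even]
      ring
    rw [h2] at h1
    linarith
  have hF := le_Ffun hU (prodD_isB hB hη)
  rw [prodD_mom hB hη (prod_mom hI q) hodd, hm] at hF
  refine le_trans ?_ hF
  unfold val
  rw [prodD_entropy hB hη, prod_entropy hI q]
  unfold val at hv
  have hq := mul_le_mul_of_nonneg_left he (Nat.cast_nonneg (α := ℝ) q)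
  rw [Real.log_pow] at hq
  push_cast at hq
  linarith

lemma main_tendsto {p q : ℕ} {U : (Fin (p + q) → ℝ) → ℝ} (hU : SuperQuadratic U)
    {G : Matrix (Fin p) (Fin p) ℝ} (hG : G.PosDef) {L : ℝ}
    (hL : Tendsto (fun s : ℝ => Phi (p + q) U (bd q G (s ^ 2))) (𝓝[>] 0) (𝓝 L)) :
    L = Phi p (fun y => U (ap y 0)) G := by
  have hdet := hG.det_pos
  have hlogdet : ∀ s : ℝ, 0 < s → Real.log (bd q G (s ^ 2)).det = Real.log G.det + 2 * q * Real.log s := by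
    intro s hs
    rw [bd_det, Real.log_mul hdet.ne' (by positivity), Real.log_pow, Real.log_pow]
    push_cast; ring
  refine le_antisymm ?_ ?_
  · obtain ⟨A, hA⟩ := dual_attained (up_super hU) hG
    have hZp := Z_pos ((up_super hU).integrable A)
    have hI := Is_tendsto hU A
    have hI0 := Is_zero U A
    have hpos : 0 < Is U A 0 := by rw [hI0]; positivity
    have hlog := ((hI.log hpos.ne').mono_left (nhdsWithin_le_nhds (s := Set.Ioi 0)))
    have hlim : Tendsto (fun s => pairM A G + q + 2 * Real.log (Is U A s) - Real.log G.det
        - ((p + q : ℕ) : ℝ) * Real.log (2 * π * Real.exp 1)) (𝓝[>] 0) (𝓝 (pairM A G + q + 2 * Real.log (Is U A 0) - Real.log G.det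
        - ((p + q : ℕ) : ℝ) * Real.log (2 * π * Real.exp 1))) :=
      (((hlog.const_mul 2).const_add _).sub_const _).sub_const _
    have hle := le_of_tendsto_of_tendsto hL hlim (by
      filter_upwards [self_mem_nhdsWithin, hlog.eventually (eventually_true _),
        (hI.mono_left (nhdsWithin_le_nhds (s := Set.Ioi 0))).eventually_const_lt hpos] with s hs _ hIs
      have hs : 0 < s := hs
      have h := Ffun_le hU (bd_posDef (q := q) hG (t := s ^ 2) (by positivity)) (bd q A (s ^ 2)⁻¹)
      rw [bd_pair, Z_scale hU.1 A hs, Real.log_mul (by positivity) hIs.ne', Real.log_pow,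
        inv_mul_cancel₀ (by positivity)] at h
      unfold Phi
      rw [hlogdet s hs]
      linarith)
    refine hle.trans (le_of_eq ?_)
    unfold Phi
    rw [← hA, hI0, Real.log_mul hZp.ne' (by positivity), Real.log_pow, Real.log_sqrt (by positivity),
      Real.log_mul (by positivity) (Real.exp_ne_zero _), Real.log_exp]
    push_cast
    ring
  · refine le_of_forall_pos_le_add fun δ hδ => ?_
    set κ := δ / (4 + 2 * q) with hκ
    have hκ0 : 0 < κ := by positivity
    have hκe : κ * (4 + 2 * q) = δ := by rw [hκ]; field_simp
    have := ge_of_tendsto (b := Phi p (fun y => U (ap y 0)) G - δ) hL (by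
      filter_upwards [self_mem_nhdsWithin, lower_bound (q := q) hU hG hκ0] with s hs h
      have hs : 0 < s := hs
      unfold Phi
      rw [hlogdet s hs]
      push_cast
      nlinarith)
    linarith

/-- Dimensional reduction at the boundary: for `1 ≤ p ≤ n`, `G_p`
symmetric positive definite `p×p`, `G` the `n×n` block-diagonal matrix with upper-left
block `G_p` and zeros elsewhere, and `U_p(y) = U(y,0)`, any continuous extension `Φext`
of the `n`-dimensional Luttinger-Ward functional to the positive semidefinite cone
satisfies `Φ_n[G; U] = Φ_p[G_p; U_p]`, i.e. `Φext G = Phi p U_p G_p`. -/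
theorem statement12 (n p : ℕ) (hp : 1 ≤ p) (hpn : p ≤ n)
    (U : (Fin n → ℝ) → ℝ) (hU : SuperQuadratic U)
    (Gp : Matrix (Fin p) (Fin p) ℝ) (hGp : Gp.PosDef)
    (G : Matrix (Fin n) (Fin n) ℝ)
    (hGdef : G = Matrix.of fun (i j : Fin n) =>
      if h : (i : ℕ) < p ∧ (j : ℕ) < p then Gp ⟨(i : ℕ), h.1⟩ ⟨(j : ℕ), h.2⟩ else 0)
    (Up : (Fin p → ℝ) → ℝ)
    (hUp : Up = fun y => U (fun (i : Fin n) => if h : (i : ℕ) < p then y ⟨(i : ℕ), h⟩ else 0))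
    (Φext : Matrix (Fin n) (Fin n) ℝ → ℝ)
    (hcont : ContinuousOn Φext {M : Matrix (Fin n) (Fin n) ℝ | M.PosSemidef})
    (hagree : ∀ M : Matrix (Fin n) (Fin n) ℝ, M.PosDef → Φext M = Phi n U M) :
    Φext G = Phi p Up Gp := by
  obtain ⟨q, rfl⟩ := Nat.exists_eq_add_of_le hpn
  have hUp' : Up = fun y => U (ap y 0) := by
    rw [hUp]
    funext y
    congr 1
    refine ap_ext ?_ ?_
    · funext i
      simp [yp, ap]
    · funext j
      simp [zp, ap]
  have hG : G = bd q Gp 0 := by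
    rw [hGdef]
    ext i j
    refine Fin.addCases (fun i => ?_) (fun i => ?_) i <;>
    refine Fin.addCases (fun j => ?_) (fun j => ?_) j <;>
    simp
  rw [hUp']
  refine main_tendsto hU hGp ?_
  have hps : G ∈ {M : Matrix (Fin (p + q)) (Fin (p + q)) ℝ | M.PosSemidef} := by
    rw [hG]; exact bd_posSemidef hGp
  have hpath : Tendsto (fun s : ℝ => bd q Gp (s ^ 2)) (𝓝[>] 0)
      (𝓝[{M : Matrix (Fin (p + q)) (Fin (p + q)) ℝ | M.PosSemidef}] G) := by
    refine tendsto_nhdsWithin_iff.2 ⟨?_, ?_⟩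
    · have h1 : Continuous fun s : ℝ => bd q Gp (s ^ 2) := (bd_cont Gp).comp (continuous_pow 2)
      have h2 := h1.tendsto 0
      simp only [ne_eq, OfNat.ofNat_ne_zero, not_false_eq_true, zero_pow, ← hG] at h2
      exact h2.mono_left nhdsWithin_le_nhds
    · filter_upwards [self_mem_nhdsWithin] with s hs
      have hs : 0 < s := hs
      exact (bd_posDef hGp (by positivity)).posSemidef
  refine ((hcont G hps).tendsto.comp hpath).congr' ?_
  filter_upwards [self_mem_nhdsWithin] with s hs
  have hs : 0 < s := hs
  exact hagree _ (bd_posDef hGp (by positivity))
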